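/- arXiv:1808.08455 — 11 statements merged into one kernel-verified Lean document; each statement's English description precedes it below -/
import Mathlib

section
/- (Lev–Smeliansky.) Let A, B ⊆ ℤ be finite nonempty sets in normal form with max(A) > max(B). Then |A + B| ≥ min{|A| + 2|B| − 2, max(A) + |B|}. -/
open Pointwise

/-- `A ⊆ G` and `B ⊆ G'` are Freiman isomorphic of order 2 (`F₂`-isomorphic): there is a
bijection `φ : A → B` preserving additive quadruples in both directions. -/
def F2Isomorphic {G G' : Type*} [AddCommGroup G] [AddCommGroup G']
    (A : Finset G) (B : Finset G') : Prop :=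
  ∃ φ : G → G', Set.BijOn φ (A : Set G) (B : Set G') ∧
    ∀ x ∈ A, ∀ y ∈ A, ∀ z ∈ A, ∀ t ∈ A,
      (x + y = z + t ↔ φ x + φ y = φ z + φ t)

/-- `B ⊆ ℤ^d` is not contained in any affine hyperplane of `ℤ^d`. -/
def NotInAffineHyperplane {d : ℕ} (B : Finset (Fin d → ℤ)) : Prop :=
  ∀ (c : Fin d → ℤ) (t : ℤ), (∀ x ∈ B, ∑ i, c i * x i = t) → c = 0

/-- There is a set `B ⊆ ℤ^d`, not contained in an affine hyperplane,
which is `F₂`-isomorphic to `A`. -/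
def HasFullDimWitness {G : Type*} [AddCommGroup G] (A : Finset G) (d : ℕ) : Prop :=
  ∃ B : Finset (Fin d → ℤ), F2Isomorphic A B ∧ NotInAffineHyperplane B

/-- `A` has additive dimension `d`: `d` is the largest natural number such that some
`B ⊆ ℤ^d` not contained in an affine hyperplane is `F₂`-isomorphic to `A`. -/
def HasAddDim {G : Type*} [AddCommGroup G] (A : Finset G) (d : ℕ) : Prop :=
  HasFullDimWitness A d ∧ ∀ d' : ℕ, HasFullDimWitness A d' → d' ≤ d

/-- The number of lattice points of `ℤ^d` in the convex hull of `B ⊆ ℤ^d`. -/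
noncomputable def hullCard {d : ℕ} (B : Finset (Fin d → ℤ)) : ℕ :=
  Set.ncard {x : Fin d → ℤ |
    (fun i => (x i : ℝ)) ∈ convexHull ℝ
      ((fun (v : Fin d → ℤ) (i : Fin d) => (v i : ℝ)) '' (B : Set (Fin d → ℤ)))}

/-- `A` has volume `v`: with `d = dim A`, `v` is the least number of lattice points in the
convex hull of a set `B ⊆ ℤ^d` that is `F₂`-isomorphic to `A`. -/
def HasVolume {G : Type*} [AddCommGroup G] (A : Finset G) (v : ℕ) : Prop :=
  ∃ d : ℕ, HasAddDim A d ∧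
    IsLeast {n : ℕ | ∃ B : Finset (Fin d → ℤ), F2Isomorphic A B ∧ hullCard B = n} v

/-- `v = vol(k,T,d)`, the largest volume of a finite set `A ⊆ ℕ` with `|A| = k`,
`|2A| = T` and `dim A = d`. -/
def IsMaxVolume (k T d v : ℕ) : Prop :=
  IsGreatest {n : ℕ | ∃ A : Finset ℤ, (∀ a ∈ A, 0 ≤ a) ∧ A.card = k ∧
    (A + A).card = T ∧ HasAddDim A d ∧ HasVolume A n} v

/-- `A` is extremal: `vol(A) = vol(|A|, |2A|, dim A)`. -/
def IsExtremal (A : Finset ℤ) : Prop :=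
  ∃ d v : ℕ, HasAddDim A d ∧ HasVolume A v ∧ IsMaxVolume A.card (A + A).card d v

/-- `P` is a decomposition of `A` into `s` segments: each `P i` is a nonempty integer
interval, `A` is their union, consecutive segments are separated by at least one hole
(`max Pᵢ + 1 < min Pᵢ₊₁`), and some segment has more than one element. -/
def IsSegmentDecomp (A : Finset ℤ) {s : ℕ} (P : Fin s → Finset ℤ) : Prop :=
  (∀ i, ∃ a b : ℤ, a ≤ b ∧ P i = Finset.Icc a b) ∧
  A = Finset.univ.biUnion P ∧
  (∀ i j : Fin s, i < j → ∀ x ∈ P i, ∀ y ∈ P j, x + 1 < y) ∧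
  (∃ i, 1 < (P i).card)

/-- `A` is the union of `s` segments. -/
def UnionOfSegments (A : Finset ℤ) (s : ℕ) : Prop :=
  ∃ P : Fin s → Finset ℤ, IsSegmentDecomp A P

section Kneser

variable {G : Type*} [AddCommGroup G] [Fintype G]

open Classical in
/-- The union of the cosets of `H` that meet `A`. -/
noncomputable def cosetHull (H : AddSubgroup G) (A : Finset G) : Finset G :=
  Finset.univ.filter fun x => ∃ a ∈ A, x - a ∈ H

theorem mem_cosetHull {H : AddSubgroup G} {A : Finset G} {x : G} :
    x ∈ cosetHull H A ↔ ∃ a ∈ A, x - a ∈ H := by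
  simp [cosetHull]

theorem mem_cosetHull_singleton {H : AddSubgroup G} {a x : G} :
    x ∈ cosetHull H {a} ↔ x - a ∈ H := by
  simp [cosetHull]

theorem cosetHull_empty (H : AddSubgroup G) : cosetHull H ∅ = ∅ := by
  simp [cosetHull]

theorem subset_cosetHull (H : AddSubgroup G) (A : Finset G) : A ⊆ cosetHull H A :=
  fun a ha => mem_cosetHull.2 ⟨a, ha, by simp⟩

theorem cosetHull_mono {H K : AddSubgroup G} {A B : Finset G} (hHK : H ≤ K) (hAB : A ⊆ B) :
    cosetHull H A ⊆ cosetHull K B := by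
  intro x hx
  obtain ⟨a, ha, hxa⟩ := mem_cosetHull.1 hx
  exact mem_cosetHull.2 ⟨a, hAB ha, hHK hxa⟩

theorem cosetHull_subset_iff {H : AddSubgroup G} {S : Finset G} :
    cosetHull H S ⊆ S ↔ ∀ x ∈ S, ∀ h ∈ H, x + h ∈ S := by
  constructor
  · intro hS x hx h hh
    exact hS (mem_cosetHull.2 ⟨x, hx, by simpa using hh⟩)
  · intro hS x hx
    obtain ⟨a, ha, hxa⟩ := mem_cosetHull.1 hx
    simpa using hS a ha _ hxa

theorem cosetHull_idem (H : AddSubgroup G) (A : Finset G) :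
    cosetHull H (cosetHull H A) ⊆ cosetHull H A := by
  intro x hx
  obtain ⟨y, hy, hxy⟩ := mem_cosetHull.1 hx
  obtain ⟨a, ha, hya⟩ := mem_cosetHull.1 hy
  exact mem_cosetHull.2 ⟨a, ha, by simpa using H.add_mem hxy hya⟩

theorem disjoint_cosetHull_singleton {H : AddSubgroup G} {a b : G} (hab : a - b ∉ H) :
    Disjoint (cosetHull H {a}) (cosetHull H {b}) := by
  rw [Finset.disjoint_left]
  intro x hxa hxb
  rw [mem_cosetHull_singleton] at hxa hxb
  exact hab (by simpa using H.sub_mem hxb hxa)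

theorem card_cosetHull_singleton (H : AddSubgroup G) (a : G) :
    (cosetHull H {a}).card = Nat.card H := by
  rw [← Nat.card_eq_finsetCard]
  refine Nat.card_congr ⟨fun x => ⟨x.1 - a, mem_cosetHull_singleton.1 x.2⟩,
    fun h => ⟨h.1 + a, mem_cosetHull_singleton.2 (by simp)⟩, ?_, ?_⟩
  · intro x; simp
  · intro x; simp

theorem card_cosetHull_le_of_subset_coset {H K : AddSubgroup G} {S : Finset G} {x : G}
    (hKH : K ≤ H) (hS : S ⊆ cosetHull H {x}) : (cosetHull K S).card ≤ Nat.card H := by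
  rw [← card_cosetHull_singleton H x]
  exact Finset.card_le_card ((cosetHull_mono hKH hS).trans (cosetHull_idem H {x}))

/-- A period of a nonempty proper subset of a coset of `H` is a proper subgroup of `H`. -/
theorem lt_of_cosetHull_subset {H K : AddSubgroup G} {S : Finset G} {x : G}
    (hS : S.Nonempty) (hSx : S ⊆ cosetHull H {x}) (hK : cosetHull K S ⊆ S)
    (hne : ¬cosetHull H {x} ⊆ S) : K < H := by
  obtain ⟨s, hs⟩ := hS
  have hsx := mem_cosetHull_singleton.1 (hSx hs)
  rw [cosetHull_subset_iff] at hK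
  refine lt_of_le_of_ne ?_ ?_
  · intro k hk
    have := mem_cosetHull_singleton.1 (hSx (hK s hs k hk))
    have h2 := H.sub_mem this hsx
    simpa using h2
  · rintro rfl
    apply hne
    intro y hy
    have := hK s hs (y - s) (by
      simpa using K.sub_mem (mem_cosetHull_singleton.1 hy) hsx)
    simpa using this

variable [DecidableEq G]

theorem cosetHull_vadd (H : AddSubgroup G) (A : Finset G) (g : G) :
    cosetHull H (g +ᵥ A) = g +ᵥ cosetHull H A := by
  ext x
  rw [Finset.mem_vadd_finset, mem_cosetHull]
  constructor
  · rintro ⟨y, hy, hxy⟩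
    obtain ⟨a, ha, rfl⟩ := Finset.mem_vadd_finset.1 hy
    refine ⟨x - g, mem_cosetHull.2 ⟨a, ha, ?_⟩, by simp⟩
    rwa [sub_sub]
  · rintro ⟨y, hy, rfl⟩
    obtain ⟨a, ha, hya⟩ := mem_cosetHull.1 hy
    exact ⟨g +ᵥ a, Finset.vadd_mem_vadd_finset ha, by simpa using hya⟩

/-- Two cosets through a common point meet in a coset of the intersection. -/
theorem card_cosetHull_union (H K : AddSubgroup G) (x : G) :
    (cosetHull H {x} ∪ cosetHull K {x}).card + Nat.card (H ⊓ K : AddSubgroup G)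
      = Nat.card H + Nat.card K := by
  have hinter : cosetHull H {x} ∩ cosetHull K {x} = cosetHull (H ⊓ K) {x} := by
    ext y
    simp [mem_cosetHull_singleton]
  rw [← card_cosetHull_singleton (H ⊓ K) x, ← hinter, Finset.card_union_add_card_inter,
    card_cosetHull_singleton, card_cosetHull_singleton]

theorem card_add_card_le_card_cosetHull (H : AddSubgroup G) {A : Finset G} {x : G}
    (hx : x ∈ A) :
    A.card + Nat.card H ≤ (cosetHull H A).card + (A ∩ cosetHull H {x}).card := by
  have hsub : A ∪ cosetHull H {x} ⊆ cosetHull H A :=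
    Finset.union_subset (subset_cosetHull H A)
      (cosetHull_mono le_rfl (Finset.singleton_subset_iff.2 hx))
  have hcard := Finset.card_union_add_card_inter A (cosetHull H {x})
  have hle := Finset.card_le_card hsub
  rw [card_cosetHull_singleton] at hcard
  omega

/-- Kneser's inequality for `A + B`, witnessed by some period of `A + B`. -/
def KneserBound (A B : Finset G) : Prop :=
  ∃ H : AddSubgroup G, cosetHull H (A + B) ⊆ A + B ∧
    (cosetHull H A).card + (cosetHull H B).card ≤ (A + B).card + Nat.card H

theorem KneserBound.of_subset {A A' B B' : Finset G} (h : KneserBound A' B')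
    (hA : A ⊆ A') (hB : B ⊆ B') (hAB : A + B = A' + B') : KneserBound A B := by
  obtain ⟨H, hH, hcard⟩ := h
  refine ⟨H, by rwa [hAB], ?_⟩
  have h1 := Finset.card_le_card (cosetHull_mono (le_refl H) hA)
  have h2 := Finset.card_le_card (cosetHull_mono (le_refl H) hB)
  rw [hAB]
  omega

theorem KneserBound.of_vadd {A B : Finset G} {g : G} (h : KneserBound A (g +ᵥ B)) :
    KneserBound A B := by
  obtain ⟨H, hH, hcard⟩ := h
  rw [add_vadd_comm, cosetHull_vadd, Finset.vadd_finset_subset_vadd_finset_iff] at hH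
  rw [add_vadd_comm, cosetHull_vadd, Finset.card_vadd_finset, Finset.card_vadd_finset] at hcard
  exact ⟨H, hH, hcard⟩

/-- DeVos's convergent sets: `C ⊆ A + B` has period `H` and satisfies Kneser's inequality for
the pair `(A ∩ B, A ∪ B)`. -/
def IsConvergent (A B C : Finset G) (H : AddSubgroup G) : Prop :=
  C.Nonempty ∧ C ⊆ A + B ∧ cosetHull H C ⊆ C ∧
    (A ∩ B).card + (cosetHull H (A ∪ B)).card ≤ C.card + Nat.card H

theorem cosetHull_union_subset {H : AddSubgroup G} {S T : Finset G}
    (hS : cosetHull H S ⊆ S) (hT : cosetHull H T ⊆ T) : cosetHull H (S ∪ T) ⊆ S ∪ T := by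
  rw [cosetHull_subset_iff] at *
  intro x hx h hh
  rcases Finset.mem_union.1 hx with hx | hx
  · exact Finset.mem_union_left _ (hS x hx h hh)
  · exact Finset.mem_union_right _ (hT x hx h hh)

theorem card_cosetHull_add_two_mul_le {H K : AddSubgroup G} (hKH : K ≤ H) {A B : Finset G}
    {a b : G} (ha : a ∈ A) (hb : b ∈ B) (hab : a - b ∉ H) :
    (cosetHull K (A ∪ B)).card + 2 * Nat.card H ≤ (cosetHull H (A ∪ B)).card
      + (cosetHull K (A ∩ cosetHull H {a})).card + (cosetHull K (B ∩ cosetHull H {b})).card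
      + (cosetHull K (A ∩ cosetHull H {b})).card + (cosetHull K (B ∩ cosetHull H {a})).card := by
  set T := cosetHull H {a} ∪ cosetHull H {b} with hT
  have hTcard : T.card = 2 * Nat.card H := by
    rw [hT, Finset.card_union_of_disjoint (disjoint_cosetHull_singleton hab),
      card_cosetHull_singleton, card_cosetHull_singleton, two_mul]
  have hTsub : T ⊆ cosetHull H (A ∪ B) :=
    Finset.union_subset (cosetHull_mono le_rfl (by simp [ha]))
      (cosetHull_mono le_rfl (by simp [hb]))
  have hsub : cosetHull K (A ∪ B) ⊆ (cosetHull H (A ∪ B) \ T)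
      ∪ cosetHull K (A ∩ cosetHull H {a}) ∪ cosetHull K (B ∩ cosetHull H {b})
      ∪ cosetHull K (A ∩ cosetHull H {b}) ∪ cosetHull K (B ∩ cosetHull H {a}) := by
    intro x hx
    obtain ⟨y, hy, hxy⟩ := mem_cosetHull.1 hx
    have hxH : x ∈ cosetHull H (A ∪ B) := cosetHull_mono hKH subset_rfl hx
    have hyx : ∀ c, x ∈ cosetHull H {c} → y ∈ cosetHull H {c} := by
      intro c hc
      rw [mem_cosetHull_singleton] at hc ⊢
      simpa using H.sub_mem hc (hKH hxy)
    by_cases hxT : x ∈ T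
    · have key : ∀ c D, y ∈ D → y ∈ cosetHull H {c} → x ∈ cosetHull K (D ∩ cosetHull H {c}) :=
        fun c D hD hc => mem_cosetHull.2 ⟨y, Finset.mem_inter.2 ⟨hD, hc⟩, hxy⟩
      simp only [Finset.mem_union] at hy ⊢
      rcases Finset.mem_union.1 hxT with hc | hc <;> have := hyx _ hc <;>
        rcases hy with hy | hy <;> simp [key _ _ hy this]
    · simp [hxH, hxT]
  have hle := Finset.card_le_card hsub
  have h1 := Finset.card_union_le
    ((cosetHull H (A ∪ B) \ T) ∪ cosetHull K (A ∩ cosetHull H {a})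
      ∪ cosetHull K (B ∩ cosetHull H {b}) ∪ cosetHull K (A ∩ cosetHull H {b}))
    (cosetHull K (B ∩ cosetHull H {a}))
  have h2 := Finset.card_union_le
    ((cosetHull H (A ∪ B) \ T) ∪ cosetHull K (A ∩ cosetHull H {a})
      ∪ cosetHull K (B ∩ cosetHull H {b})) (cosetHull K (A ∩ cosetHull H {b}))
  have h3 := Finset.card_union_le
    ((cosetHull H (A ∪ B) \ T) ∪ cosetHull K (A ∩ cosetHull H {a}))
    (cosetHull K (B ∩ cosetHull H {b}))
  have h4 := Finset.card_union_le (cosetHull H (A ∪ B) \ T)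
    (cosetHull K (A ∩ cosetHull H {a}))
  have h5 := Finset.card_sdiff_add_card_eq_card hTsub
  omega

theorem card_cosetHull_add_le {H K : AddSubgroup G} (hKH : K ≤ H) {A B : Finset G}
    {a b : G} (ha : a ∈ A) (hab : a - b ∈ H) :
    (cosetHull K (A ∪ B)).card + Nat.card H ≤ (cosetHull H (A ∪ B)).card
      + (cosetHull K (A ∩ cosetHull H {a})).card
      + (cosetHull K (B ∩ cosetHull H {b})).card := by
  set T := cosetHull H {a} with hT
  have hTsub : T ⊆ cosetHull H (A ∪ B) := cosetHull_mono le_rfl (by simp [ha])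
  have hsub : cosetHull K (A ∪ B) ⊆ (cosetHull H (A ∪ B) \ T)
      ∪ cosetHull K (A ∩ T) ∪ cosetHull K (B ∩ cosetHull H {b}) := by
    intro x hx
    obtain ⟨y, hy, hxy⟩ := mem_cosetHull.1 hx
    have hxH : x ∈ cosetHull H (A ∪ B) := cosetHull_mono hKH subset_rfl hx
    by_cases hxT : x ∈ T
    · have hya : y ∈ T := by
        rw [hT, mem_cosetHull_singleton] at hxT ⊢
        simpa using H.sub_mem hxT (hKH hxy)
      have hyb : y ∈ cosetHull H {b} := by
        rw [hT, mem_cosetHull_singleton] at hya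
        rw [mem_cosetHull_singleton]
        simpa using H.add_mem hya hab
      rcases Finset.mem_union.1 hy with hy | hy
      · have : x ∈ cosetHull K (A ∩ T) := mem_cosetHull.2 ⟨y, by simp [hy, hya], hxy⟩
        simp [this]
      · have : x ∈ cosetHull K (B ∩ cosetHull H {b}) :=
          mem_cosetHull.2 ⟨y, by simp [hy, hyb], hxy⟩
        simp [this]
    · simp [hxH, hxT]
  have hle := Finset.card_le_card hsub
  have h1 := Finset.card_union_le
    ((cosetHull H (A ∪ B) \ T) ∪ cosetHull K (A ∩ T)) (cosetHull K (B ∩ cosetHull H {b}))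
  have h2 := Finset.card_union_le (cosetHull H (A ∪ B) \ T) (cosetHull K (A ∩ T))
  have h3 := Finset.card_sdiff_add_card_eq_card hTsub
  have h4 : T.card = Nat.card H := card_cosetHull_singleton H a
  omega

theorem inter_coset_add_inter_coset_subset (H : AddSubgroup G) (A B : Finset G) (a b : G) :
    (A ∩ cosetHull H {a}) + (B ∩ cosetHull H {b}) ⊆ (A + B) ∩ cosetHull H {a + b} := by
  intro x hx
  obtain ⟨y, hy, z, hz, rfl⟩ := Finset.mem_add.1 hx
  rw [Finset.mem_inter, mem_cosetHull_singleton] at hy hz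
  refine Finset.mem_inter.2 ⟨Finset.add_mem_add hy.1 hz.1, mem_cosetHull_singleton.2 ?_⟩
  rw [add_sub_add_comm]
  exact H.add_mem hy.2 hz.2

/-- If `H` has least cardinality among the subgroups belonging to convergent sets, then `A + B`
has period `H`. -/
theorem cosetHull_add_subset_of_isConvergent {A B C : Finset G} {H : AddSubgroup G}
    (hC : IsConvergent A B C H)
    (hmin : ∀ C' K, IsConvergent A B C' K → Nat.card H ≤ Nat.card K)
    (ih : ∀ A' B' : Finset G, A'.Nonempty → B'.Nonempty → (A' + B').card < (A + B).card →
      KneserBound A' B') :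
    cosetHull H (A + B) ⊆ A + B := by
  by_contra hnot
  obtain ⟨hCne, hCsub, hCper, hCcard⟩ := hC
  obtain ⟨x, hx, hxAB⟩ := Finset.not_subset.1 hnot
  obtain ⟨s, hs, hxs⟩ := mem_cosetHull.1 hx
  obtain ⟨a, ha, b, hb, rfl⟩ := Finset.mem_add.1 hs
  have hxab : x ∈ cosetHull H {a + b} := mem_cosetHull_singleton.2 hxs
  have hdisjC : Disjoint C (cosetHull H {a + b}) := by
    rw [Finset.disjoint_left]
    intro y hyC hy
    rw [mem_cosetHull_singleton] at hy
    refine hxAB (hCsub (hCper (mem_cosetHull.2 ⟨y, hyC, ?_⟩)))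
    simpa using H.sub_mem hxs hy
  have hlt : ∀ K : AddSubgroup G, K < H → Nat.card K < Nat.card H := by
    intro K hK
    exact Set.Finite.card_lt_card (Set.toFinite _) hK
  have hnonconv : ∀ (S : Finset G) (K : AddSubgroup G), K < H →
      S ⊆ (A + B) ∩ cosetHull H {a + b} → cosetHull K S ⊆ S →
      C.card + S.card + Nat.card K < (A ∩ B).card + (cosetHull K (A ∪ B)).card := by
    intro S K hK hS hSper
    by_contra! hle
    refine (hlt K hK).not_ge (hmin (C ∪ S) K ⟨hCne.mono Finset.subset_union_left,
      Finset.union_subset hCsub (hS.trans Finset.inter_subset_left),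
      cosetHull_union_subset ((cosetHull_mono hK.le subset_rfl).trans hCper) hSper, ?_⟩)
    rwa [Finset.card_union_of_disjoint (hdisjC.mono_right (hS.trans Finset.inter_subset_right))]
  have hpart : ∀ A' B' : Finset G, A'.Nonempty → B'.Nonempty →
      A' + B' ⊆ (A + B) ∩ cosetHull H {a + b} → ∃ K < H, cosetHull K (A' + B') ⊆ A' + B' ∧
        (cosetHull K A').card + (cosetHull K B').card ≤ (A' + B').card + Nat.card K := by
    intro A' B' hA' hB' hsub
    obtain ⟨K, hKper, hKcard⟩ := ih A' B' hA' hB' (Finset.card_lt_card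
      ⟨hsub.trans Finset.inter_subset_left, fun hcon => by
        obtain ⟨c, hc⟩ := hCne
        exact Finset.disjoint_left.1 hdisjC hc
          (Finset.mem_inter.1 (hsub (hcon (hCsub hc)))).2⟩)
    exact ⟨K, lt_of_cosetHull_subset (hA'.add hB') (hsub.trans Finset.inter_subset_right) hKper
      fun hcon => hxAB (Finset.mem_inter.1 (hsub (hcon hxab))).1, hKper, hKcard⟩
  have hself : ∀ (c : G) (D : Finset G), c ∈ D → (D ∩ cosetHull H {c}).Nonempty :=
    fun c D hc => ⟨c, by simp [hc, mem_cosetHull_singleton]⟩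
  have hS₁ := inter_coset_add_inter_coset_subset H A B a b
  have hS₂ : (A ∩ cosetHull H {b}) + (B ∩ cosetHull H {a}) ⊆ (A + B) ∩ cosetHull H {a + b} := by
    rw [add_comm a b]
    exact inter_coset_add_inter_coset_subset H A B b a
  obtain ⟨H₁, hH₁, hper₁, hcard₁⟩ := hpart _ _ (hself a A ha) (hself b B hb) hS₁
  have hnc₁ := hnonconv _ H₁ hH₁ hS₁ hper₁
  by_cases hab : a - b ∈ H
  · have := card_cosetHull_add_le hH₁.le (B := B) ha hab
    omega
  have hcnt₁ := card_cosetHull_add_two_mul_le hH₁.le ha hb hab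
  have hA₂ : (A ∩ cosetHull H {b}).Nonempty := by
    by_contra hem
    rw [Finset.not_nonempty_iff_eq_empty] at hem
    have h0 : (cosetHull H₁ (A ∩ cosetHull H {b})).card = 0 := by
      rw [hem, cosetHull_empty, Finset.card_empty]
    have := card_cosetHull_le_of_subset_coset hH₁.le
      (Finset.inter_subset_right : B ∩ cosetHull H {a} ⊆ _)
    omega
  have hB₂ : (B ∩ cosetHull H {a}).Nonempty := by
    by_contra hem
    rw [Finset.not_nonempty_iff_eq_empty] at hem
    have h0 : (cosetHull H₁ (B ∩ cosetHull H {a})).card = 0 := by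
      rw [hem, cosetHull_empty, Finset.card_empty]
    have := card_cosetHull_le_of_subset_coset hH₁.le
      (Finset.inter_subset_right : A ∩ cosetHull H {b} ⊆ _)
    omega
  obtain ⟨H₂, hH₂, hper₂, hcard₂⟩ := hpart _ _ hA₂ hB₂ hS₂
  have hKH : H₁ ⊓ H₂ < H := inf_le_left.trans_lt hH₁
  have hnc := hnonconv _ (H₁ ⊓ H₂) hKH (Finset.union_subset hS₁ hS₂)
    (cosetHull_union_subset ((cosetHull_mono inf_le_left subset_rfl).trans hper₁)
      ((cosetHull_mono inf_le_right subset_rfl).trans hper₂))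
  have hcnt := card_cosetHull_add_two_mul_le hKH.le ha hb hab
  have e₁ := Finset.card_le_card
    (cosetHull_mono (inf_le_left : H₁ ⊓ H₂ ≤ H₁) (subset_refl (A ∩ cosetHull H {a})))
  have e₂ := Finset.card_le_card
    (cosetHull_mono (inf_le_left : H₁ ⊓ H₂ ≤ H₁) (subset_refl (B ∩ cosetHull H {b})))
  have e₃ := Finset.card_le_card
    (cosetHull_mono (inf_le_right : H₁ ⊓ H₂ ≤ H₂) (subset_refl (A ∩ cosetHull H {b})))
  have e₄ := Finset.card_le_card
    (cosetHull_mono (inf_le_right : H₁ ⊓ H₂ ≤ H₂) (subset_refl (B ∩ cosetHull H {a})))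
  set S₁ := (A ∩ cosetHull H {a}) + (B ∩ cosetHull H {b})
  set S₂ := (A ∩ cosetHull H {b}) + (B ∩ cosetHull H {a})
  have hxS : ∀ (K : AddSubgroup G) (S : Finset G), S ⊆ (A + B) ∩ cosetHull H {a + b} →
      cosetHull K S ⊆ S → Disjoint (cosetHull K {x}) S := by
    intro K S hS hper
    rw [Finset.disjoint_left]
    intro y hy hyS
    rw [mem_cosetHull_singleton] at hy
    refine hxAB (Finset.mem_inter.1 (hS (hper (mem_cosetHull.2 ⟨y, hyS, ?_⟩)))).1
    simpa using K.neg_mem hy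
  have hdisj : Disjoint (S₁ ∩ S₂) (cosetHull H₁ {x} ∪ cosetHull H₂ {x}) :=
    Finset.disjoint_union_right.2
      ⟨((hxS H₁ S₁ hS₁ hper₁).mono_right Finset.inter_subset_left).symm,
        ((hxS H₂ S₂ hS₂ hper₂).mono_right Finset.inter_subset_right).symm⟩
  have hxcos : cosetHull H {x} ⊆ cosetHull H {a + b} :=
    (cosetHull_mono le_rfl (Finset.singleton_subset_iff.2 hxab)).trans (cosetHull_idem H _)
  have hle := Finset.card_le_card (Finset.union_subset
    ((Finset.inter_subset_left.trans hS₁).trans Finset.inter_subset_right :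
      S₁ ∩ S₂ ⊆ cosetHull H {a + b})
    (Finset.union_subset ((cosetHull_mono hH₁.le subset_rfl).trans hxcos)
      ((cosetHull_mono hH₂.le subset_rfl).trans hxcos)))
  rw [Finset.card_union_of_disjoint hdisj, card_cosetHull_singleton] at hle
  have hu := card_cosetHull_union H₁ H₂ x
  have hS := Finset.card_union_add_card_inter S₁ S₂
  omega

/-- **Kneser's theorem** for finite abelian groups. -/
theorem kneser (A B : Finset G) (hA : A.Nonempty) : KneserBound A B := by
  obtain ⟨a₀, ha₀⟩ := id hA
  by_cases hstab : ∀ a ∈ A, ∀ a' ∈ A, ∀ b ∈ B, b + (a' - a) ∈ B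
  · set K := AddAction.stabilizer G B
    have hK : ∀ k ∈ K, ∀ b ∈ B, b + k ∈ B := by
      intro k hk b hb
      have := Finset.vadd_mem_vadd_finset (a := k) hb
      rwa [AddAction.mem_stabilizer_iff.1 hk, vadd_eq_add, add_comm] at this
    have hAK : A ⊆ cosetHull K {a₀} := by
      intro a ha
      refine mem_cosetHull_singleton.2 (AddAction.mem_stabilizer_iff.2
        (Finset.eq_of_subset_of_card_le ?_ (Finset.card_vadd_finset _ _).ge))
      intro x hx
      obtain ⟨b, hb, rfl⟩ := Finset.mem_vadd_finset.1 hx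
      rw [vadd_eq_add, add_comm]
      exact hstab a₀ ha₀ a ha b hb
    refine ⟨K, cosetHull_subset_iff.2 ?_, ?_⟩
    · intro x hx k hk
      obtain ⟨a, ha, b, hb, rfl⟩ := Finset.mem_add.1 hx
      rw [add_assoc]
      exact Finset.add_mem_add ha (hK k hk b hb)
    · have h1 := card_cosetHull_le_of_subset_coset le_rfl hAK
      have h2 := Finset.card_le_card (cosetHull_subset_iff.2 fun b hb k hk => hK k hk b hb)
      have h3 := Finset.card_le_card_add_left (t := B) hA
      omega
  push Not at hstab
  obtain ⟨a, ha, a', ha', b, hb, hbB⟩ := hstab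
  refine KneserBound.of_vadd (g := a - b) ?_
  set B' := (a - b) +ᵥ B with hB'
  have haB : a ∈ B' := Finset.mem_vadd_finset.2 ⟨b, hb, by simp⟩
  have haB' : a' ∉ B' := by
    intro h
    obtain ⟨c, hc, hca⟩ := Finset.mem_vadd_finset.1 h
    rw [vadd_eq_add] at hca
    exact hbB (by rw [← hca]; convert hc using 1; abel)
  have hcardB' : (A + B').card = (A + B).card := by
    rw [hB', add_vadd_comm, Finset.card_vadd_finset]
  have hcB : B'.card = B.card := Finset.card_vadd_finset _ _
  have hsub : (A ∩ B') + (A ∪ B') ⊆ A + B' := by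
    intro x hx
    obtain ⟨y, hy, z, hz, rfl⟩ := Finset.mem_add.1 hx
    rw [Finset.mem_inter] at hy
    rcases Finset.mem_union.1 hz with hz | hz
    · rw [add_comm y z]
      exact Finset.add_mem_add hz hy.2
    · exact Finset.add_mem_add hy.1 hz
  have hlt : (A ∩ B').card < A.card :=
    Finset.card_lt_card ⟨Finset.inter_subset_left, fun h => haB' (Finset.mem_inter.1 (h ha')).2⟩
  have hcard := Finset.card_inter_add_card_union A B'
  have hsubcard := Finset.card_le_card hsub
  have hne : (A ∩ B').Nonempty := ⟨a, Finset.mem_inter.2 ⟨ha, haB⟩⟩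
  have hne' : (A ∪ B').Nonempty :=
    hne.mono (Finset.inter_subset_left.trans Finset.subset_union_left)
  have hconv : ∃ n, ∃ C H, IsConvergent A B' C H ∧ Nat.card H = n := by
    obtain ⟨H, hH, hHcard⟩ := kneser (A ∩ B') (A ∪ B') hne
    have := Finset.card_le_card (subset_cosetHull H (A ∩ B'))
    exact ⟨_, _, H, ⟨hne.add hne', hsub, hH, by omega⟩, rfl⟩
  classical
  obtain ⟨C, H, hC, hHn⟩ := Nat.find_spec hconv
  have hper := cosetHull_add_subset_of_isConvergent hC
    (fun C' K hC' => hHn.trans_le (Nat.find_min' hconv ⟨C', K, hC', rfl⟩))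
    (fun A' D hA' _ _ => kneser A' D hA')
  have hadd : cosetHull H A + cosetHull H B' = A + B' := by
    refine subset_antisymm ?_ (Finset.add_subset_add (subset_cosetHull H A) (subset_cosetHull H B'))
    refine subset_trans ?_ hper
    intro x hx
    obtain ⟨y, hy, z, hz, rfl⟩ := Finset.mem_add.1 hx
    obtain ⟨c, hc, hyc⟩ := mem_cosetHull.1 hy
    obtain ⟨d, hd, hzd⟩ := mem_cosetHull.1 hz
    refine mem_cosetHull.2 ⟨c + d, Finset.add_mem_add hc hd, ?_⟩
    rw [add_sub_add_comm]
    exact H.add_mem hyc hzd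
  have h1 := Finset.card_le_card (subset_cosetHull H A)
  have h2 := Finset.card_le_card (subset_cosetHull H B')
  by_cases heq : (cosetHull H A).card + (cosetHull H B').card = A.card + B'.card
  · refine ⟨H, hper, ?_⟩
    have := Finset.card_le_card (subset_cosetHull H (A ∪ B'))
    have := hC.2.2.2
    have := Finset.card_le_card hC.2.1
    omega
  · have h3 := (cosetHull H A).card_le_univ
    have h4 := (cosetHull H B').card_le_univ
    exact (kneser (cosetHull H A) (cosetHull H B') (hA.mono (subset_cosetHull H A))).of_subset
      (subset_cosetHull H A) (subset_cosetHull H B') hadd.symm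
termination_by ((A + B).card, 2 * Fintype.card G - (A.card + B.card), A.card)
decreasing_by
  · simp only [Prod.lex_def]
    rw [← hB']
    have := (A ∩ B').card_le_univ
    have := (A ∪ B').card_le_univ
    omega
  · simp only [Prod.lex_def]
    omega
  · simp only [Prod.lex_def]
    rw [← hB', hadd]
    omega

end Kneser

/-- If `X` contains `B` and `B + l`, where `B ⊆ [0, l)`, then `X` has at least `|B|` more elements
than its reduction modulo `l`. -/
theorem card_image_cast_add_card_le {l : ℕ} {X B : Finset ℤ}
    (hB : ∀ b ∈ B, b < l) (hB0 : ∀ b ∈ B, 0 ≤ b) (hBX : ∀ b ∈ B, b ∈ X ∧ b + l ∈ X) :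
    (X.image (Int.cast : ℤ → ZMod l)).card + B.card ≤ X.card := by
  set Y := B.image (· + (l : ℤ)) with hY
  have hYcard : Y.card = B.card :=
    Finset.card_image_of_injective _ (add_left_injective _)
  have hYX : Y ⊆ X := by
    intro y hy
    obtain ⟨b, hb, rfl⟩ := Finset.mem_image.1 hy
    exact (hBX b hb).2
  have himage : X.image (Int.cast : ℤ → ZMod l) ⊆ (X \ Y).image Int.cast := by
    intro z hz
    obtain ⟨x, hx, rfl⟩ := Finset.mem_image.1 hz
    by_cases hxY : x ∈ Y
    · obtain ⟨b, hb, rfl⟩ := Finset.mem_image.1 hxY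
      refine Finset.mem_image.2 ⟨b, Finset.mem_sdiff.2 ⟨(hBX b hb).1, fun hbY => ?_⟩, by simp⟩
      obtain ⟨c, hc, hcb⟩ := Finset.mem_image.1 hbY
      have := hB b hb
      have := hB0 c hc
      omega
    · exact Finset.mem_image_of_mem _ (Finset.mem_sdiff.2 ⟨hx, hxY⟩)
  have h1 := (Finset.card_le_card himage).trans Finset.card_image_le
  have h2 := Finset.card_sdiff_add_card_eq_card hYX
  omega

theorem card_image_cast_of_mem_Ico {l : ℕ} {X : Finset ℤ}
    (hX : ∀ x ∈ X, 0 ≤ x ∧ x < l) : (X.image (Int.cast : ℤ → ZMod l)).card = X.card := by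
  refine Finset.card_image_of_injOn fun x hx y hy hxy => ?_
  have h := (ZMod.intCast_eq_intCast_iff' x y l).1 hxy
  rwa [Int.emod_eq_of_lt (hX x hx).1 (hX x hx).2, Int.emod_eq_of_lt (hX y hy).1 (hX y hy).2] at h

theorem eq_top_of_forall_cast_mem {l : ℕ} {A : Finset ℤ} (hgcd : A.gcd id = 1)
    {H : AddSubgroup (ZMod l)} (hH : ∀ a ∈ A, (a : ZMod l) ∈ H) : H = ⊤ := by
  obtain ⟨d, hd⟩ := Int.subgroup_cyclic (H.comap (Int.castAddHom (ZMod l)))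
  have hmem : ∀ z : ℤ, (z : ZMod l) ∈ H ↔ d ∣ z := by
    intro z
    have : (z : ZMod l) ∈ H ↔ z ∈ H.comap (Int.castAddHom (ZMod l)) := Iff.rfl
    rw [this, hd, ← AddSubgroup.zmultiples_eq_closure, Int.mem_zmultiples_iff]
  have hd1 : d ∣ 1 := hgcd ▸ Finset.dvd_gcd fun a ha => (hmem a).1 (hH a ha)
  rw [AddSubgroup.eq_top_iff']
  intro x
  obtain ⟨z, rfl⟩ := ZMod.intCast_surjective x
  exact (hmem z).2 (hd1.trans (one_dvd z))

/-- Theorem 4.2 (Lev–Smeliansky): for `A, B ⊆ ℤ` in normal form with `max A > max B`,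
`|A + B| ≥ min (|A| + 2|B| - 2) (max A + |B|)`. -/
theorem lev_smeliansky (A B : Finset ℤ) (hA : A.Nonempty) (hB : B.Nonempty)
    (hminA : A.min' hA = 0) (hgcdA : A.gcd id = 1)
    (hminB : B.min' hB = 0) (hgcdB : B.gcd id = 1)
    (hmax : B.max' hB < A.max' hA) :
    min ((A.card : ℤ) + 2 * (B.card : ℤ) - 2) (A.max' hA + (B.card : ℤ))
      ≤ ((A + B).card : ℤ) := by
  set l := (A.max' hA).toNat with hl
  have h0A : (0 : ℤ) ∈ A := hminA ▸ A.min'_mem hA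
  have h0B : (0 : ℤ) ∈ B := hminB ▸ B.min'_mem hB
  have hA0 : ∀ a ∈ A, 0 ≤ a := fun a ha => hminA ▸ A.min'_le a ha
  have hB0 : ∀ b ∈ B, 0 ≤ b := fun b hb => hminB ▸ B.min'_le b hb
  have hlA : (l : ℤ) = A.max' hA := Int.toNat_of_nonneg (hA0 _ (A.max'_mem hA))
  have hlmem : (l : ℤ) ∈ A := hlA ▸ A.max'_mem hA
  have hAl : ∀ a ∈ A, a ≤ l := fun a ha => hlA ▸ A.le_max' a ha
  have hBl : ∀ b ∈ B, b < l := fun b hb => hlA ▸ (B.le_max' b hb).trans_lt hmax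
  rw [← hlA]
  have hlpos := hBl 0 h0B
  have : NeZero l := ⟨by omega⟩
  set π : ℤ → ZMod l := Int.cast with hπ
  set A' := A.image π with hA'
  set B' := B.image π with hB'
  have hAB' : (A + B).image π = A' + B' :=
    Finset.image_add (Int.castRingHom (ZMod l))
  have hcardA : A.card ≤ A'.card + 1 := by
    have h1 : ((A.erase l).image π).card = (A.erase l).card :=
      card_image_cast_of_mem_Ico fun x hx => ⟨hA0 x (Finset.mem_of_mem_erase hx),
        lt_of_le_of_ne (hAl x (Finset.mem_of_mem_erase hx)) (Finset.ne_of_mem_erase hx)⟩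
    have h2 : ((A.erase l).image π).card ≤ A'.card :=
      Finset.card_le_card (Finset.image_subset_image (A.erase_subset _))
    have h3 := Finset.card_erase_add_one hlmem
    omega
  have hcardB : B'.card = B.card :=
    card_image_cast_of_mem_Ico fun x hx => ⟨hB0 x hx, hBl x hx⟩
  have hBsub : ∀ b ∈ B, b ∈ A + B ∧ b + l ∈ A + B := fun b hb =>
    ⟨by simpa using Finset.add_mem_add h0A hb,
      by simpa [add_comm] using Finset.add_mem_add hlmem hb⟩
  have h0A' : (0 : ZMod l) ∈ A' := Finset.mem_image.2 ⟨0, h0A, by simp [hπ]⟩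
  have h0B' : (0 : ZMod l) ∈ B' := Finset.mem_image.2 ⟨0, h0B, by simp [hπ]⟩
  obtain ⟨H, hper, hH⟩ := kneser A' B' ⟨0, h0A'⟩
  by_cases hAH : ∀ a ∈ A, π a ∈ H
  · have htop := eq_top_of_forall_cast_mem hgcdA hAH
    have huniv : A' + B' = Finset.univ := by
      rw [Finset.eq_univ_iff_forall]
      intro x
      refine hper (mem_cosetHull.2 ⟨0 + 0, Finset.add_mem_add h0A' h0B', ?_⟩)
      simp [htop]
    have hle := card_image_cast_add_card_le hBl hB0 hBsub
    rw [← hπ, hAB', huniv, Finset.card_univ, ZMod.card] at hle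
    omega
  push Not at hAH
  obtain ⟨a, ha, haH⟩ := hAH
  have htwo : 2 * Nat.card H ≤ (cosetHull H A').card := by
    have hsub : cosetHull H {0} ∪ cosetHull H {π a} ⊆ cosetHull H A' :=
      Finset.union_subset (cosetHull_mono le_rfl (Finset.singleton_subset_iff.2 h0A'))
        (cosetHull_mono le_rfl
          (Finset.singleton_subset_iff.2 (Finset.mem_image_of_mem π ha)))
    have h := Finset.card_le_card hsub
    rwa [Finset.card_union_of_disjoint (disjoint_cosetHull_singleton (by simpa using haH)),
      card_cosetHull_singleton, card_cosetHull_singleton, ← two_mul] at h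
  have hnsub : ¬A' + B' ⊆ cosetHull H B' := fun hsub => by
    have := Finset.card_le_card hsub
    have : 0 < Nat.card H := Nat.card_pos
    omega
  obtain ⟨x, hx, hxB⟩ := Finset.not_subset.1 hnsub
  obtain ⟨_, hi', _, hj', rfl⟩ := Finset.mem_add.1 hx
  obtain ⟨i, hi, rfl⟩ := Finset.mem_image.1 hi'
  obtain ⟨j, hj, rfl⟩ := Finset.mem_image.1 hj'
  set E := cosetHull H {π i + π j} with hE
  have hEsub : E ⊆ A' + B' :=
    (cosetHull_mono le_rfl (Finset.singleton_subset_iff.2 hx)).trans hper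
  have hBE : ∀ b ∈ B, π b ∉ E := fun b hb hbE => by
    rw [hE, mem_cosetHull_singleton] at hbE
    refine hxB (mem_cosetHull.2 ⟨π b, Finset.mem_image_of_mem π hb, ?_⟩)
    simpa using H.neg_mem hbE
  set X := (A + B).filter fun z => π z ∉ E with hX
  have hXcard : (A' + B').card + B.card ≤ X.card + Nat.card H := by
    have hle : (X.image π).card + B.card ≤ X.card :=
      card_image_cast_add_card_le hBl hB0 fun b hb =>
        ⟨Finset.mem_filter.2 ⟨(hBsub b hb).1, hBE b hb⟩,
        Finset.mem_filter.2 ⟨(hBsub b hb).2, by simpa [hπ] using hBE b hb⟩⟩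
    have himage : (A' + B') \ E ⊆ X.image π := by
      intro y hy
      rw [Finset.mem_sdiff, ← hAB', Finset.mem_image] at hy
      obtain ⟨⟨z, hz, rfl⟩, hyE⟩ := hy
      exact Finset.mem_image_of_mem π (Finset.mem_filter.2 ⟨hz, hyE⟩)
    have h1 := Finset.card_le_card himage
    have h2 := Finset.card_sdiff_add_card_eq_card hEsub
    rw [hE, card_cosetHull_singleton, ← hE] at h2
    omega
  set Ai := A.filter fun z => π z ∈ cosetHull H {π i} with hAi
  set Bj := B.filter fun z => π z ∈ cosetHull H {π j} with hBj
  have hself : ∀ c, π c ∈ cosetHull H {π c} := fun c => by simp [mem_cosetHull_singleton]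
  have hdavenport : Ai.card + Bj.card - 1 ≤ (Ai + Bj).card :=
    cauchy_davenport_add_of_linearOrder_isCancelAdd
      ⟨i, Finset.mem_filter.2 ⟨hi, hself i⟩⟩ ⟨j, Finset.mem_filter.2 ⟨hj, hself j⟩⟩
  have hpart : (Ai + Bj).card + X.card ≤ (A + B).card := by
    have hsub : Ai + Bj ⊆ (A + B).filter fun z => ¬π z ∉ E := by
      intro z hz
      obtain ⟨p, hp, q, hq, rfl⟩ := Finset.mem_add.1 hz
      rw [Finset.mem_filter, mem_cosetHull_singleton] at hp hq
      refine Finset.mem_filter.2 ⟨Finset.add_mem_add hp.1 hq.1, not_not.2 ?_⟩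
      rw [hE, mem_cosetHull_singleton]
      have := H.add_mem hp.2 hq.2
      rwa [← add_sub_add_comm, hπ, ← Int.cast_add, ← hπ] at this
    have h1 := Finset.card_le_card hsub
    have h2 : X.card + ((A + B).filter fun z => ¬π z ∉ E).card = (A + B).card :=
      Finset.card_filter_add_card_filter_not _
    omega
  have hfib : ∀ (D : Finset ℤ) (c : ℤ), (D.image π ∩ cosetHull H {π c}).card
      ≤ (D.filter fun z => π z ∈ cosetHull H {π c}).card := by
    intro D c
    refine (Finset.card_le_card ?_).trans (Finset.card_image_le (f := π))
    intro y hy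
    obtain ⟨hyD, hyc⟩ := Finset.mem_inter.1 hy
    obtain ⟨z, hz, rfl⟩ := Finset.mem_image.1 hyD
    exact Finset.mem_image_of_mem π (Finset.mem_filter.2 ⟨hz, hyc⟩)
  have h1 := card_add_card_le_card_cosetHull H hi'
  have h2 := card_add_card_le_card_cosetHull H hj'
  have h3 : (A' ∩ cosetHull H {π i}).card ≤ Ai.card := hfib A i
  have h4 : (B' ∩ cosetHull H {π j}).card ≤ Bj.card := hfib B j
  omega
end

section
/- Let A ⊆ ℤ be the union of s disjoint segments P₁, …, P_s. Then |2A| ≤ (s+1)|A| − s(s+1)/2, with equality if and only if the sumsets P_i + P_j for 1 ≤ i ≤ j ≤ s are pairwise disjoint; moreover, in the case of equality the additive dimension of A equals s. -/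
open Pointwise

open Finset in
theorem card_biUnion_eq_sum_iff_pairwiseDisjoint {ι α : Type*} [DecidableEq ι] [DecidableEq α]
    (T : Finset ι) (S : ι → Finset α) :
    #(T.biUnion S) = ∑ p ∈ T, #(S p) ↔ ∀ p ∈ T, ∀ q ∈ T, p ≠ q → Disjoint (S p) (S q) := by
  refine ⟨fun h p hp q hq hpq => ?_, fun h => Finset.card_biUnion h⟩
  have hsplit : T.biUnion S = S p ∪ (T.erase p).biUnion S := by
    conv_lhs => rw [← Finset.insert_erase hp, Finset.biUnion_insert]
  have hle : #((T.erase p).biUnion S) ≤ ∑ r ∈ T.erase p, #(S r) := Finset.card_biUnion_le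
  have hsum := Finset.add_sum_erase T (fun r => #(S r)) hp
  have hcard := Finset.card_union_add_card_inter (S p) ((T.erase p).biUnion S)
  rw [← hsplit] at hcard
  have hzero : #(S p ∩ (T.erase p).biUnion S) = 0 := by omega
  rw [Finset.card_eq_zero, ← Finset.disjoint_iff_inter_eq_empty] at hzero
  exact hzero.mono_right
    (Finset.subset_biUnion_of_mem S (Finset.mem_erase.2 ⟨hpq.symm, hq⟩))

theorem two_mul_sum_filter_fst_le_snd {ι : Type*} [Fintype ι] [LinearOrder ι]
    (f : ι → ι → ℤ) (hf : ∀ i j, f i j = f j i) :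
    2 * ∑ p : ι × ι with p.1 ≤ p.2, f p.1 p.2 = ∑ i, ∑ j, f i j + ∑ i, f i i := by
  have h1 : ∑ p : ι × ι with p.1 ≤ p.2, f p.1 p.2 = ∑ i, ∑ j, if i ≤ j then f i j else 0 := by
    rw [Finset.sum_filter, Fintype.sum_prod_type]
  have h2 : ∑ p : ι × ι with p.1 ≤ p.2, f p.1 p.2 = ∑ i, ∑ j, if j ≤ i then f i j else 0 := by
    rw [h1, Finset.sum_comm]
    simp only [hf]
  have h3 : ∑ i, f i i = ∑ i, ∑ j, if i = j then f i j else 0 := by simp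
  rw [two_mul]
  nth_rewrite 1 [h1]
  rw [h2, h3]
  simp only [← Finset.sum_add_distrib]
  refine Finset.sum_congr rfl fun i _ => Finset.sum_congr rfl fun j _ => ?_
  rcases lt_trichotomy i j with h | h | h
  · simp [h.le, h.not_ge, h.ne]
  · simp [h]
  · simp [h.le, h.not_ge, h.ne']

theorem Int.card_Icc_add_Icc {a b c d : ℤ} (hab : a ≤ b) (hcd : c ≤ d) :
    ((Finset.Icc a b + Finset.Icc c d).card : ℤ) =
      (Finset.Icc a b).card + (Finset.Icc c d).card - 1 := by
  have h : Finset.Icc a b + Finset.Icc c d = Finset.Icc (a + c) (b + d) := by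
    ext x
    simp only [Finset.mem_add, Finset.mem_Icc]
    constructor
    · rintro ⟨y, hy, z, hz, rfl⟩
      omega
    · intro hx
      exact ⟨max a (x - d), by omega, x - max a (x - d), by omega, by omega⟩
  rw [h]
  simp only [Int.card_Icc]
  omega

theorem pair_eq_of_add_eq_of_disjoint {s : ℕ} {P : Fin s → Finset ℤ}
    (hd : ∀ i j i' j' : Fin s, i ≤ j → i' ≤ j' → (i, j) ≠ (i', j') →
      Disjoint (P i + P j) (P i' + P j'))
    {x y z t : ℤ} {i j k l : Fin s} (hx : x ∈ P i) (hy : y ∈ P j) (hz : z ∈ P k)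
    (ht : t ∈ P l) (h : x + y = z + t) : (i = k ∧ j = l) ∨ (i = l ∧ j = k) := by
  have key : ∀ {x y z t : ℤ} {i j k l : Fin s}, x ∈ P i → y ∈ P j → z ∈ P k → t ∈ P l →
      x + y = z + t → i ≤ j → k ≤ l → i = k ∧ j = l := by
    intro x y z t i j k l hx hy hz ht h hij hkl
    by_contra hne
    refine Finset.disjoint_left.1 (hd i j k l hij hkl fun he => hne (Prod.mk.inj he))
      (Finset.add_mem_add hx hy) ?_
    rw [h]
    exact Finset.add_mem_add hz ht
  rcases le_total i j with h1 | h1 <;> rcases le_total k l with h2 | h2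
  · exact Or.inl (key hx hy hz ht h h1 h2)
  · exact Or.inr (key hx hy ht hz (by omega) h1 h2)
  · exact Or.inr (key hy hx hz ht (by omega) h1 h2).symm
  · exact Or.inl (key hy hx ht hz (by omega) h1 h2).symm

namespace IsSegmentDecomp

variable {A : Finset ℤ} {s : ℕ} {P : Fin s → Finset ℤ}

theorem mem_iff (hP : IsSegmentDecomp A P) {x : ℤ} : x ∈ A ↔ ∃ i, x ∈ P i := by
  rw [hP.2.1]
  simp

theorem disjoint (hP : IsSegmentDecomp A P) {i j : Fin s} (hij : i ≠ j) :
    Disjoint (P i) (P j) := by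
  rw [Finset.disjoint_left]
  intro x hi hj
  rcases lt_or_gt_of_ne hij with h | h
  · have := hP.2.2.1 i j h x hi x hj
    omega
  · have := hP.2.2.1 j i h x hj x hi
    omega

theorem eq_of_mem (hP : IsSegmentDecomp A P) {i j : Fin s} {x : ℤ} (hi : x ∈ P i)
    (hj : x ∈ P j) : i = j := by
  by_contra h
  exact Finset.disjoint_left.1 (hP.disjoint h) hi hj

theorem nonempty (hP : IsSegmentDecomp A P) (i : Fin s) : (P i).Nonempty := by
  obtain ⟨a, b, hab, h⟩ := hP.1 i
  exact h ▸ Finset.nonempty_Icc.2 hab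

theorem card_eq_sum (hP : IsSegmentDecomp A P) : (A.card : ℤ) = ∑ i, ((P i).card : ℤ) := by
  rw [hP.2.1, Finset.card_biUnion fun i _ j _ hij => hP.disjoint hij]
  push_cast
  rfl

theorem card_add (hP : IsSegmentDecomp A P) (i j : Fin s) :
    ((P i + P j).card : ℤ) = (P i).card + (P j).card - 1 := by
  obtain ⟨a, b, hab, hi⟩ := hP.1 i
  obtain ⟨c, d, hcd, hj⟩ := hP.1 j
  rw [hi, hj, Int.card_Icc_add_Icc hab hcd]

theorem add_self_eq_biUnion (hP : IsSegmentDecomp A P) :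
    A + A = (Finset.univ.filter fun p : Fin s × Fin s => p.1 ≤ p.2).biUnion
      fun p => P p.1 + P p.2 := by
  ext x
  simp only [Finset.mem_add, hP.mem_iff, Finset.mem_biUnion, Finset.mem_filter,
    Finset.mem_univ, true_and, Prod.exists]
  constructor
  · rintro ⟨y, ⟨i, hi⟩, z, ⟨j, hj⟩, rfl⟩
    rcases le_total i j with h | h
    · exact ⟨i, j, h, y, hi, z, hj, rfl⟩
    · exact ⟨j, i, h, z, hj, y, hi, add_comm z y⟩
  · rintro ⟨i, j, -, y, hi, z, hj, rfl⟩
    exact ⟨y, ⟨i, hi⟩, z, ⟨j, hj⟩, rfl⟩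

theorem sum_card_add (hP : IsSegmentDecomp A P) :
    ∑ p : Fin s × Fin s with p.1 ≤ p.2, ((P p.1 + P p.2).card : ℤ) =
      ((s : ℤ) + 1) * A.card - s * (s + 1) / 2 := by
  have h := two_mul_sum_filter_fst_le_snd (fun i j => ((P i + P j).card : ℤ))
    fun i j => by rw [add_comm]
  have hrhs : ∑ i, ∑ j, ((P i + P j).card : ℤ) + ∑ i, ((P i + P i).card : ℤ) =
      2 * (((s : ℤ) + 1) * A.card) - s * (s + 1) := by
    simp only [hP.card_add, Finset.sum_sub_distrib, Finset.sum_add_distrib,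
      Finset.sum_const, Finset.card_univ, Fintype.card_fin, nsmul_eq_mul, ← Finset.mul_sum,
      ← hP.card_eq_sum, mul_one]
    ring
  rw [hrhs] at h
  have heven := Int.two_mul_ediv_two_of_even (Int.even_mul_succ_self (s : ℤ))
  linarith

theorem exists_consecutive (hP : IsSegmentDecomp A P) :
    ∃ (i : Fin s) (u : ℤ), u ∈ P i ∧ u + 1 ∈ P i := by
  obtain ⟨i, hi⟩ := hP.2.2.2
  obtain ⟨a, b, -, h⟩ := hP.1 i
  rw [h, Int.card_Icc] at hi
  refine ⟨i, a, ?_, ?_⟩ <;> rw [h, Finset.mem_Icc] <;> omega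

theorem const_on_segment (hP : IsSegmentDecomp A P) {f : ℤ → ℤ}
    (hf : ∀ x, x ∈ A → x + 1 ∈ A → f (x + 1) = f x) (i : Fin s) {x y : ℤ}
    (hx : x ∈ P i) (hy : y ∈ P i) : f x = f y := by
  obtain ⟨a, b, -, h⟩ := hP.1 i
  have hA : ∀ z, a ≤ z → z ≤ b → z ∈ A := fun z h1 h2 =>
    hP.mem_iff.2 ⟨i, h ▸ Finset.mem_Icc.2 ⟨h1, h2⟩⟩
  have key : ∀ z, a ≤ z → z ≤ b → f z = f a := by
    intro z hz
    induction z, hz using Int.leInduction with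
    | base => exact fun _ => rfl
    | succ z hz ih =>
      intro hb
      rw [hf z (hA z hz (by omega)) (hA _ (by omega) hb), ih (by omega)]
  rw [h, Finset.mem_Icc] at hx hy
  rw [key x hx.1 hx.2, key y hy.1 hy.2]

theorem le_of_hasFullDimWitness (hP : IsSegmentDecomp A P) {d : ℕ}
    (hd : HasFullDimWitness A d) : d ≤ s := by
  obtain ⟨B, ⟨φ, hφ, hiso⟩, hB⟩ := hd
  obtain ⟨i₀, u, hu, hu'⟩ := hP.exists_consecutive
  choose p hp using hP.nonempty
  let w : Fin s → Fin d → ℤ := fun i => if i = i₀ then φ (u + 1) - φ u else φ (p i) - φ (p i₀)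
  refine le_of_fin_injective ℤ (Matrix.mulVecLin (Matrix.of w)) ?_
  rw [injective_iff_map_eq_zero]
  intro c hc
  have hw : ∀ i, w i ⬝ᵥ c = 0 := fun i => congrFun hc i
  have hstep : φ (u + 1) ⬝ᵥ c = φ u ⬝ᵥ c := by
    have := hw i₀
    simp only [w, if_pos, sub_dotProduct] at this
    exact sub_eq_zero.1 this
  have hbase : ∀ i, φ (p i) ⬝ᵥ c = φ (p i₀) ⬝ᵥ c := by
    intro i
    by_cases hi : i = i₀
    · rw [hi]
    · have := hw i
      simp only [w, if_neg hi, sub_dotProduct] at this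
      exact sub_eq_zero.1 this
  have hconst : ∀ x, x ∈ A → x + 1 ∈ A → φ (x + 1) ⬝ᵥ c = φ x ⬝ᵥ c := by
    intro x hx hx'
    have h := (hiso (x + 1) hx' u (hP.mem_iff.2 ⟨i₀, hu⟩) x hx (u + 1)
      (hP.mem_iff.2 ⟨i₀, hu'⟩)).1 (by ring)
    have h' := congrArg (fun v => v ⬝ᵥ c) h
    simp only [add_dotProduct] at h'
    linarith
  refine hB c (φ (p i₀) ⬝ᵥ c) fun b hb => ?_
  obtain ⟨x, hx, rfl⟩ := hφ.surjOn hb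
  obtain ⟨i, hi⟩ := hP.mem_iff.1 hx
  rw [← hbase i, ← hP.const_on_segment (f := fun z => φ z ⬝ᵥ c) hconst i hi (hp i)]
  exact dotProduct_comm c (φ x)

theorem hasFullDimWitness (hP : IsSegmentDecomp A P)
    (hd : ∀ i j i' j' : Fin s, i ≤ j → i' ≤ j' → (i, j) ≠ (i', j') →
      Disjoint (P i + P j) (P i' + P j')) : HasFullDimWitness A s := by
  obtain ⟨i₀, u, hu, hu'⟩ := hP.exists_consecutive
  let φ : ℤ → Fin s → ℤ := fun x i => if i = i₀ then x else if x ∈ P i then 1 else 0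
  have hφ₀ : ∀ x, φ x i₀ = x := fun x => if_pos rfl
  have hφ : ∀ {x : ℤ} {k : Fin s}, x ∈ P k → ∀ i, i ≠ i₀ → φ x i = if i = k then 1 else 0 := by
    intro x k hx i hi
    simp only [φ, if_neg hi]
    refine if_congr ⟨fun h => hP.eq_of_mem h hx, fun h => h ▸ hx⟩ rfl rfl
  refine ⟨A.image φ, ⟨φ, ⟨?_, ?_, ?_⟩, ?_⟩, ?_⟩
  · exact fun x hx => Finset.mem_coe.2 (Finset.mem_image_of_mem φ hx)
  · intro x _ y _ h
    rw [← hφ₀ x, h, hφ₀]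
  · intro y hy
    simpa using hy
  · intro x hx y hy z hz t ht
    obtain ⟨i, hi⟩ := hP.mem_iff.1 hx
    obtain ⟨j, hj⟩ := hP.mem_iff.1 hy
    obtain ⟨k, hk⟩ := hP.mem_iff.1 hz
    obtain ⟨l, hl⟩ := hP.mem_iff.1 ht
    constructor
    · intro h
      funext m
      by_cases hm : m = i₀
      · simpa only [hm, Pi.add_apply, hφ₀] using h
      · simp only [Pi.add_apply, hφ hi m hm, hφ hj m hm, hφ hk m hm, hφ hl m hm]
        rcases pair_eq_of_add_eq_of_disjoint hd hi hj hk hl h with ⟨rfl, rfl⟩ | ⟨rfl, rfl⟩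
        · rfl
        · exact add_comm _ _
    · intro h
      simpa only [Pi.add_apply, hφ₀] using congrFun h i₀
  · intro c t hc
    have hval : ∀ {x : ℤ} {k : Fin s}, x ∈ P k →
        c i₀ * x + (if k = i₀ then 0 else c k) = t := by
      intro x k hx
      rw [← hc (φ x) (Finset.mem_image_of_mem φ (hP.mem_iff.2 ⟨k, hx⟩)),
        ← Finset.add_sum_erase _ _ (Finset.mem_univ i₀), hφ₀]
      congr 1
      rw [Finset.sum_congr rfl fun i hi => by rw [hφ hx i (Finset.ne_of_mem_erase hi)]]
      by_cases hk : k = i₀ <;> simp [hk]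
    have h1 := hval hu
    have h2 := hval hu'
    simp only [if_pos] at h1 h2
    have hc₀ : c i₀ = 0 := by linarith
    have ht : t = 0 := by rw [← h1, hc₀]; simp
    funext k
    by_cases hk : k = i₀
    · rw [hk, hc₀, Pi.zero_apply]
    · obtain ⟨x, hx⟩ := hP.nonempty k
      simpa [hc₀, ht, hk] using hval hx

end IsSegmentDecomp

/-- Equation (10): a union of `s` disjoint segments satisfies
`|2A| ≤ (s+1)|A| - s(s+1)/2`, with equality iff the sumsets `Pᵢ + Pⱼ`, `i ≤ j`,
are pairwise disjoint; in the case of equality `dim A = s`. -/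
theorem doubling_segments_bound (A : Finset ℤ) (s : ℕ) (P : Fin s → Finset ℤ)
    (hP : IsSegmentDecomp A P) :
    ((A + A).card : ℤ) ≤ ((s : ℤ) + 1) * A.card - s * (s + 1) / 2 ∧
    (((A + A).card : ℤ) = ((s : ℤ) + 1) * A.card - s * (s + 1) / 2 ↔
      ∀ i j i' j' : Fin s, i ≤ j → i' ≤ j' → (i, j) ≠ (i', j') →
        Disjoint (P i + P j) (P i' + P j')) ∧
    (((A + A).card : ℤ) = ((s : ℤ) + 1) * A.card - s * (s + 1) / 2 → HasAddDim A s) := by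
  have hiff : ((A + A).card : ℤ) = ((s : ℤ) + 1) * A.card - s * (s + 1) / 2 ↔
      ∀ i j i' j' : Fin s, i ≤ j → i' ≤ j' → (i, j) ≠ (i', j') →
        Disjoint (P i + P j) (P i' + P j') := by
    rw [← hP.sum_card_add, hP.add_self_eq_biUnion, ← Nat.cast_sum, Nat.cast_inj,
      card_biUnion_eq_sum_iff_pairwiseDisjoint]
    constructor
    · intro h i j i' j' hij hij' hne
      exact h (i, j) (by simpa using hij) (i', j') (by simpa using hij') hne
    · intro h p hp q hq hpq
      exact h p.1 p.2 q.1 q.2 (by simpa using hp) (by simpa using hq) hpq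
  refine ⟨?_, hiff, fun h =>
    ⟨hP.hasFullDimWitness (hiff.1 h), fun d' hd' => hP.le_of_hasFullDimWitness hd'⟩⟩
  rw [← hP.sum_card_add, hP.add_self_eq_biUnion]
  exact_mod_cast Finset.card_biUnion_le
end

section
/- Let A ⊆ ℤ be a finite set of cardinality k and additive dimension d. Then (d+1)k − C(d+1,2) ≤ |2A| ≤ C(k,2) + d + 1, where C(n,2) = n(n−1)/2; that is, (d+1)k − d(d+1)/2 ≤ |2A| ≤ k(k−1)/2 + d + 1. -/
open Pointwise

/-- Freiman's lemma: if `ψ` maps additive quadruples of a set `A` of `k` elements to additive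
quadruples, and `ψ '' A` spans a space of dimension `r`, then `r k - r (r - 1) / 2 ≤ |2A|`. -/
theorem finrank_image_mul_card_le_card_add {G K V : Type*} [AddCommGroup G] [LinearOrder G]
    [IsOrderedAddMonoid G] [Field K] [AddCommGroup V] [Module K V] (ψ : G → V) (A : Finset G)
    (hψ : ∀ x ∈ A, ∀ y ∈ A, ∀ z ∈ A, ∀ t ∈ A, x + y = z + t → ψ x + ψ y = ψ z + ψ t) :
    2 * (Set.finrank K (ψ '' A) : ℤ) * A.card
      - Set.finrank K (ψ '' A) * (Set.finrank K (ψ '' A) - 1) ≤ 2 * (A + A).card := by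
  classical
  induction A using Finset.induction_on_max with
  | empty =>
    have h : Set.finrank K (ψ '' ((∅ : Finset G) : Set G)) = 0 := by
      simp only [Finset.coe_empty, Set.image_empty, Set.finrank_empty]
    rw [h]
    simp
  | insert x s hx ih =>
    have hxs : x ∉ s := fun h => lt_irrefl _ (hx x h)
    have ih := ih fun a ha b hb c hc e he =>
      hψ a (Finset.mem_insert_of_mem ha) b (Finset.mem_insert_of_mem hb)
        c (Finset.mem_insert_of_mem hc) e (Finset.mem_insert_of_mem he)
    set Y := s.filter (fun y => x + y ∉ s + s) with hY
    have hYs : Y ⊆ s := Finset.filter_subset _ _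
    have hxY : x ∉ Y := fun h => hxs (hYs h)
    have hrel : ∀ y ∈ s, y ∉ Y → ∃ u ∈ s, ∃ v ∈ s, u + v = x + y ∧ ψ x + ψ y = ψ u + ψ v := by
      intro y hy hyY
      have : x + y ∈ s + s := by simpa [hY, hy] using hyY
      obtain ⟨u, hu, v, hv, huv⟩ := Finset.mem_add.1 this
      exact ⟨u, hu, v, hv, huv, hψ x (Finset.mem_insert_self _ _) y (Finset.mem_insert_of_mem hy)
        u (Finset.mem_insert_of_mem hu) v (Finset.mem_insert_of_mem hv) huv.symm⟩
    have hcard : (s + s).card + (Y.card + 1)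
        ≤ (insert x s + insert x s).card := by
      have hinj : ((insert x Y).image (x + ·)).card = Y.card + 1 := by
        rw [Finset.card_image_of_injective _ (add_right_injective x),
          Finset.card_insert_of_notMem hxY]
      rw [← hinj, ← Finset.card_union_of_disjoint]
      · apply Finset.card_le_card
        apply Finset.union_subset
        · exact Finset.add_subset_add (Finset.subset_insert _ _) (Finset.subset_insert _ _)
        · intro z hz
          obtain ⟨y, hy, rfl⟩ := Finset.mem_image.1 hz
          exact Finset.add_mem_add (Finset.mem_insert_self _ _)
            (Finset.insert_subset_insert x hYs hy)
      · rw [Finset.disjoint_right]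
        intro z hz
        obtain ⟨y, hy, rfl⟩ := Finset.mem_image.1 hz
        rcases Finset.mem_insert.1 hy with rfl | hy
        · intro h
          obtain ⟨u, hu, v, hv, huv⟩ := Finset.mem_add.1 h
          exact (add_lt_add (hx u hu) (hx v hv)).ne huv
        · exact (Finset.mem_filter.1 hy).2
    have hspan : ∀ y ∈ s, ψ y ∈ Submodule.span K (ψ '' (insert x Y : Finset G)) := by
      by_contra! hcon
      obtain ⟨y₀, hy₀, hbad₀⟩ := hcon
      obtain ⟨y, hy, hmax⟩ := Finset.exists_max_image
        (s.filter (fun y => ψ y ∉ Submodule.span K (ψ '' (insert x Y : Finset G)))) id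
        ⟨y₀, Finset.mem_filter.2 ⟨hy₀, hbad₀⟩⟩
      obtain ⟨hys, hbad⟩ := Finset.mem_filter.1 hy
      have hgood : ∀ u ∈ s, y < u → ψ u ∈ Submodule.span K (ψ '' (insert x Y : Finset G)) := by
        intro u hu hyu
        by_contra h
        exact absurd (hmax u (Finset.mem_filter.2 ⟨hu, h⟩)) (not_le.2 hyu)
      have hyY : y ∉ Y := fun h =>
        hbad (Submodule.subset_span ⟨y, Finset.mem_insert_of_mem h, rfl⟩)
      obtain ⟨u, hu, v, hv, huv, hψuv⟩ := hrel y hys hyY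
      have hyu : y < u := by
        by_contra! h
        exact (add_lt_add_of_le_of_lt h (hx v hv)).ne (by rw [huv, add_comm])
      have hyv : y < v := by
        by_contra! h
        exact (add_lt_add_of_lt_of_le (hx u hu) h).ne huv
      apply hbad
      rw [eq_sub_of_add_eq' hψuv]
      exact sub_mem (add_mem (hgood u hu hyu) (hgood v hv hyv))
        (Submodule.subset_span ⟨x, Finset.mem_insert_self _ _, rfl⟩)
    have hrY : Set.finrank K (ψ '' (insert x s : Finset G)) ≤ Y.card + 1 := by
      rw [← Finset.card_insert_of_notMem hxY]
      refine le_trans ?_ (Finset.card_image_le (s := insert x Y) (f := ψ))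
      refine le_trans (Submodule.finrank_mono ?_) (finrank_span_finset_le_card (R := K) _)
      rw [Submodule.span_le, Finset.coe_image]
      rintro _ ⟨y, hy, rfl⟩
      rcases Finset.mem_insert.1 hy with rfl | hy
      · exact Submodule.subset_span ⟨y, Finset.mem_insert_self _ _, rfl⟩
      · exact hspan y hy
    rw [Finset.card_insert_of_notMem hxs]
    by_cases hmem : ψ x ∈ Submodule.span K (ψ '' s)
    · have hr : Set.finrank K (ψ '' (insert x s : Finset G)) = Set.finrank K (ψ '' s) := by
        unfold Set.finrank
        rw [Finset.coe_insert, Set.image_insert_eq, Submodule.span_insert_eq_span hmem]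
      rw [hr] at hrY ⊢
      push_cast
      zify at hrY hcard
      linarith
    · have hYeq : Y = s := by
        refine hYs.antisymm fun y hy => ?_
        by_contra hyY
        obtain ⟨u, hu, v, hv, -, hψuv⟩ := hrel y hy hyY
        apply hmem
        rw [eq_sub_of_add_eq hψuv]
        exact sub_mem (add_mem (Submodule.subset_span ⟨u, hu, rfl⟩)
          (Submodule.subset_span ⟨v, hv, rfl⟩)) (Submodule.subset_span ⟨y, hy, rfl⟩)
      have hr : Set.finrank K (ψ '' (insert x s : Finset G)) = Set.finrank K (ψ '' s) + 1 := by
        have hψx : ψ x ≠ 0 := fun h => hmem (h ▸ zero_mem _)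
        have hdisj : Disjoint (Submodule.span K {ψ x}) (Submodule.span K (ψ '' s)) :=
          ((Submodule.disjoint_span_singleton' hψx).2 hmem).symm
        have : FiniteDimensional K (Submodule.span K (ψ '' s)) :=
          FiniteDimensional.span_of_finite K (s.finite_toSet.image ψ)
        have h := Submodule.finrank_sup_add_finrank_inf_eq
          (Submodule.span K {ψ x}) (Submodule.span K (ψ '' s))
        rw [hdisj.eq_bot, finrank_bot, finrank_span_singleton hψx] at h
        unfold Set.finrank
        rw [Finset.coe_insert, Set.image_insert_eq, Submodule.span_insert]
        omega
      rw [hYeq] at hcard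
      rw [hr]
      push_cast
      zify at hcard
      linarith

/-- Clearing denominators in a finite family of rationals. -/
theorem exists_int_multiples {ι : Type*} [Finite ι] (f : ι → ℚ) :
    ∃ N : ℤ, N ≠ 0 ∧ ∃ g : ι → ℤ, ∀ i, (g i : ℚ) = N * f i := by
  obtain ⟨N, hN⟩ := IsLocalization.exist_integer_multiples_of_finite (nonZeroDivisors ℤ) f
  choose g hg using hN
  refine ⟨N, nonZeroDivisors.coe_ne_zero N, g, fun i => ?_⟩
  simpa using hg i

/-- A set `B ⊆ ℤ^d` not contained in an affine hyperplane has full homogeneous span. -/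
theorem span_homogenization_eq_top {d : ℕ} {B : Finset (Fin d → ℤ)} (hne : B.Nonempty)
    (hB : NotInAffineHyperplane B) :
    Submodule.span ℚ ((fun v : Fin d → ℤ => ((1 : ℚ), fun i => (v i : ℚ))) '' B) = ⊤ := by
  by_contra h
  obtain ⟨ℓ, hℓ, hle⟩ := Submodule.exists_le_ker_of_lt_top _ (lt_top_iff_ne_top.2 h)
  obtain ⟨N, hN, g, hg⟩ := exists_int_multiples
    (fun o : Option (Fin d) => o.elim (ℓ (1, 0)) fun i => ℓ (0, Pi.single i 1))
  have hexp : ∀ (a : ℚ) (w : Fin d → ℚ),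
      ℓ (a, w) = a * ℓ (1, 0) + ∑ i, w i * ℓ (0, Pi.single i 1) := by
    intro a w
    have hw : (a, w) = a • ((1 : ℚ), (0 : Fin d → ℚ)) +
        ∑ i, w i • ((0 : ℚ), (Pi.single i 1 : Fin d → ℚ)) := by
      ext j
      · simp [Prod.fst_sum]
      · simp [Prod.snd_sum, Finset.sum_apply, Pi.single_apply]
    rw [hw]
    simp only [map_add, map_sum, map_smul, smul_eq_mul]
  have hzero : ∀ v ∈ B, ℓ (1, fun i => (v i : ℚ)) = 0 := fun v hv =>
    hle (Submodule.subset_span ⟨v, hv, rfl⟩)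
  have hc := hB (fun i => g (some i)) (-g none) (by
    intro v hv
    have h1 := hzero v hv
    rw [hexp] at h1
    have h2 : ((∑ i, g (some i) * v i : ℤ) : ℚ) = ((-g none : ℤ) : ℚ) := by
      push_cast
      rw [hg none]
      simp only [hg, Option.elim]
      have h3 : ∑ i, N * ℓ (0, Pi.single i 1) * (v i : ℚ)
          = N * ∑ i, (v i : ℚ) * ℓ (0, Pi.single i 1) := by
        rw [Finset.mul_sum]
        exact Finset.sum_congr rfl fun i _ => by ring
      rw [h3]
      linear_combination (N : ℚ) * h1
    exact_mod_cast h2)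
  have hsing : ∀ i, ℓ (0, Pi.single i 1) = 0 := by
    intro i
    have h1 := hg (some i)
    rw [congrFun hc i] at h1
    simpa [hN] using h1.symm
  obtain ⟨v, hv⟩ := hne
  have h0 : ℓ (1, 0) = 0 := by
    have h1 := hzero v hv
    rw [hexp] at h1
    simpa [hsing] using h1
  apply hℓ
  ext p
  · simp [h0]
  · simpa using hsing p

/-- The normalized Freiman homomorphisms `A → ℚ`, with the values `g` they induce on `A + A`, form
the kernel of this map; `a` is the element of `A` at which they are required to vanish. -/
noncomputable def freimanRelationMap (A : Finset ℤ) (a : A) :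
    ((A → ℚ) × ((A + A : Finset ℤ) → ℚ)) →ₗ[ℚ] (Sym2 A → ℚ) × ℚ :=
  LinearMap.prod
    { toFun := fun p => Sym2.lift ⟨fun x y =>
        p.1 x + p.1 y - p.2 ⟨x.1 + y.1, Finset.add_mem_add x.2 y.2⟩,
        fun x y => by simp only [add_comm]⟩
      map_add' := fun p q => funext <| Sym2.ind fun x y => by
        simp only [Sym2.lift_mk, Prod.fst_add, Prod.snd_add, Pi.add_apply]
        ring
      map_smul' := fun c p => funext <| Sym2.ind fun x y => by
        simp only [Sym2.lift_mk, Prod.smul_fst, Prod.smul_snd, Pi.smul_apply, smul_eq_mul,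
          RingHom.id_apply]
        ring }
    (LinearMap.proj a ∘ₗ LinearMap.fst ℚ (A → ℚ) _)

theorem mem_ker_freimanRelationMap {A : Finset ℤ} {a : A}
    {p : (A → ℚ) × ((A + A : Finset ℤ) → ℚ)} :
    p ∈ LinearMap.ker (freimanRelationMap A a) ↔
      (∀ x y : A, p.1 x + p.1 y = p.2 ⟨x.1 + y.1, Finset.add_mem_add x.2 y.2⟩) ∧ p.1 a = 0 := by
  simp [freimanRelationMap, funext_iff, Sym2.forall, sub_eq_zero]

theorem card_add_card_le_finrank_ker (A : Finset ℤ) (a : A) :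
    A.card + (A + A).card ≤
      Module.finrank ℚ (LinearMap.ker (freimanRelationMap A a)) + (A.card + 1).choose 2 + 1 := by
  have h1 := LinearMap.finrank_range_add_finrank_ker (freimanRelationMap A a)
  have h2 := Submodule.finrank_le (LinearMap.range (freimanRelationMap A a))
  simp only [Module.finrank_prod, Module.finrank_fintype_fun_eq_card, Fintype.card_coe,
    Sym2.card, Module.finrank_self] at h1 h2
  omega

theorem hasFullDimWitness_finrank_ker (A : Finset ℤ) (a : A) :
    HasFullDimWitness A (Module.finrank ℚ (LinearMap.ker (freimanRelationMap A a))) := by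
  classical
  set W := LinearMap.ker (freimanRelationMap A a)
  set b := Module.finBasis ℚ W
  obtain ⟨N, hN, g, hg⟩ := exists_int_multiples
    (fun q : Fin (Module.finrank ℚ W) × A => (b q.1).1.1 q.2)
  have hNQ : (N : ℚ) ≠ 0 := by exact_mod_cast hN
  let φ : ℤ → Fin (Module.finrank ℚ W) → ℤ := fun x i => if h : x ∈ A then g (i, ⟨x, h⟩) else 0
  have hφ : ∀ (x : A) i, (φ x i : ℚ) = N * (b i).1.1 x := by
    intro x i
    simp [φ, hg]
  have hW : ∀ w : W, ∀ x : A, w.1.1 x = ∑ i, b.repr w i * (b i).1.1 x := by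
    intro w x
    have h := congrArg (LinearMap.proj x ∘ₗ LinearMap.fst ℚ (A → ℚ) _ ∘ₗ W.subtype)
      (b.sum_repr w)
    rw [map_sum] at h
    simp only [map_smul, smul_eq_mul] at h
    exact h.symm
  have hid : ((fun x : A => (x.1 : ℚ) - a.1),
      (fun z : (A + A : Finset ℤ) => (z.1 : ℚ) - 2 * a.1)) ∈ W := by
    refine mem_ker_freimanRelationMap.2 ⟨fun x y => ?_, ?_⟩
    · push_cast
      ring
    · simp
  have hquad : ∀ x ∈ A, ∀ y ∈ A, ∀ z ∈ A, ∀ t ∈ A,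
      (x + y = z + t ↔ φ x + φ y = φ z + φ t) := by
    intro x hx y hy z hz t ht
    constructor
    · intro h
      funext i
      have hb := (mem_ker_freimanRelationMap.1 (b i).2).1
      have h1 := hb ⟨x, hx⟩ ⟨y, hy⟩
      have h2 := hb ⟨z, hz⟩ ⟨t, ht⟩
      simp only [h] at h1
      have h3 : ((φ x i + φ y i : ℤ) : ℚ) = ((φ z i + φ t i : ℤ) : ℚ) := by
        push_cast
        rw [hφ ⟨x, hx⟩, hφ ⟨y, hy⟩, hφ ⟨z, hz⟩, hφ ⟨t, ht⟩]
        linear_combination (N : ℚ) * (h1 - h2)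
      exact_mod_cast h3
    · intro h
      have hb : ∀ i, (b i).1.1 ⟨x, hx⟩ + (b i).1.1 ⟨y, hy⟩
          = (b i).1.1 ⟨z, hz⟩ + (b i).1.1 ⟨t, ht⟩ := by
        intro i
        have h3 : ((φ x i + φ y i : ℤ) : ℚ) = ((φ z i + φ t i : ℤ) : ℚ) := by
          exact_mod_cast congrFun h i
        push_cast at h3
        rw [hφ ⟨x, hx⟩, hφ ⟨y, hy⟩, hφ ⟨z, hz⟩, hφ ⟨t, ht⟩, ← mul_add, ← mul_add] at h3
        exact mul_left_cancel₀ hNQ h3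
      have h4 : ((x : ℚ) - a.1) + (y - a.1) = (z - a.1) + (t - a.1) := by
        have e := hW ⟨_, hid⟩
        have ex := e ⟨x, hx⟩
        have ey := e ⟨y, hy⟩
        have ez := e ⟨z, hz⟩
        have et := e ⟨t, ht⟩
        dsimp only at ex ey ez et
        rw [ex, ey, ez, et, ← Finset.sum_add_distrib, ← Finset.sum_add_distrib]
        refine Finset.sum_congr rfl fun i _ => ?_
        rw [← mul_add, ← mul_add, hb i]
      have h5 : (x : ℚ) + y = z + t := by linarith
      exact_mod_cast h5
  refine ⟨A.image φ, ⟨φ, ?_, hquad⟩, ?_⟩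
  · rw [Finset.coe_image]
    refine Set.InjOn.bijOn_image fun x hx y hy hxy => ?_
    have := (hquad x hx x hx y hy x hx).2 (by rw [hxy])
    exact add_right_cancel this
  · intro c t hc
    have hsum : ∀ x : A, (N : ℚ) * ∑ i, (c i : ℚ) * (b i).1.1 x = t := by
      intro x
      rw [← hc (φ x) (Finset.mem_image_of_mem φ x.2), Finset.mul_sum]
      push_cast
      refine Finset.sum_congr rfl fun i _ => ?_
      rw [hφ]
      ring
    have ht : (t : ℚ) = 0 := by
      rw [← hsum a]
      simp [fun i => (mem_ker_freimanRelationMap.1 (b i).2).2]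
    have hzero : ∀ x : A, ∑ i, (c i : ℚ) * (b i).1.1 x = 0 := fun x => by
      simpa [ht, hNQ] using hsum x
    have hcomb : ∑ i, (c i : ℚ) • b i = 0 := by
      have hfst : (∑ i, (c i : ℚ) • b i : W).1.1 = 0 := by
        funext x
        simpa [Prod.fst_sum, Finset.sum_apply] using hzero x
      refine Subtype.ext (Prod.ext hfst (funext ?_))
      rintro ⟨z, hz⟩
      obtain ⟨u, hu, v, hv, rfl⟩ := Finset.mem_add.1 hz
      have := (mem_ker_freimanRelationMap.1 (∑ i, (c i : ℚ) • b i : W).2).1 ⟨u, hu⟩ ⟨v, hv⟩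
      rw [hfst] at this
      simpa using this.symm
    funext i
    have := Fintype.linearIndependent_iff.1 b.linearIndependent (fun i => (c i : ℚ)) hcomb i
    exact_mod_cast this

/-- Equation (2) (Freiman; Konyagin–Lev): a set of cardinality `k` and additive
dimension `d` satisfies `(d+1)k - C(d+1,2) ≤ |2A| ≤ C(k,2) + d + 1`. -/
theorem doubling_dimension_bounds (A : Finset ℤ) (k d : ℕ)
    (hk : A.card = k) (hd : HasAddDim A d) :
    ((d : ℤ) + 1) * k - (d : ℤ) * (d + 1) / 2 ≤ ((A + A).card : ℤ) ∧
    ((A + A).card : ℤ) ≤ (k : ℤ) * (k - 1) / 2 + d + 1 := by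
  have hdd : (d : ℤ) * (d + 1) / 2 * 2 = d * (d + 1) :=
    Int.ediv_mul_cancel (Int.even_mul_succ_self d).two_dvd
  have hkk : (k : ℤ) * (k - 1) / 2 * 2 = k * (k - 1) :=
    Int.ediv_mul_cancel (Int.even_mul_pred_self k).two_dvd
  rcases A.eq_empty_or_nonempty with rfl | hne
  · obtain rfl : k = 0 := by simpa using hk.symm
    have : 0 ≤ (d : ℤ) * (d + 1) / 2 := by positivity
    simp
    omega
  obtain ⟨⟨B, ⟨φ, hbij, hquad⟩, hB⟩, hmax⟩ := hd
  constructor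
  · have hBne : B.Nonempty := by
      obtain ⟨a, ha⟩ := hne
      exact ⟨φ a, hbij.mapsTo ha⟩
    have h := finrank_image_mul_card_le_card_add (K := ℚ)
      (fun x => ((1 : ℚ), fun i => (φ x i : ℚ))) A (by
        intro x hx y hy z hz t ht h
        have h1 := (hquad x hx y hy z hz t ht).1 h
        refine Prod.ext rfl (funext fun i => ?_)
        have h2 := congrFun h1 i
        simp only [Pi.add_apply] at h2
        simp only [Prod.snd_add, Pi.add_apply]
        exact_mod_cast h2)
    have hr : Set.finrank ℚ ((fun x => ((1 : ℚ), fun i => (φ x i : ℚ))) '' A) = d + 1 := by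
      have himg : (fun x => ((1 : ℚ), fun i => (φ x i : ℚ))) '' (A : Set ℤ)
          = (fun v : Fin d → ℤ => ((1 : ℚ), fun i => (v i : ℚ))) '' B := by
        rw [← hbij.image_eq, Set.image_image]
      rw [himg, Set.finrank, span_homogenization_eq_top hBne hB]
      simp [add_comm]
    rw [hr, hk] at h
    push_cast at h
    linarith
  · obtain ⟨a, ha⟩ := hne
    have h1 := hmax _ (hasFullDimWitness_finrank_ker A ⟨a, ha⟩)
    have h2 := card_add_card_le_finrank_ker A ⟨a, ha⟩
    have h3 : ((k + 1).choose 2 : ℤ) * 2 = (k + 1) * k := by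
      exact_mod_cast (by
        rw [Nat.choose_two_right, Nat.add_sub_cancel]
        exact Nat.div_mul_cancel (mul_comm k (k + 1) ▸ (Nat.even_mul_succ_self k).two_dvd) :
          (k + 1).choose 2 * 2 = (k + 1) * k)
    rw [hk] at h2
    zify at h1 h2
    linarith
end

section
/- Let P₁ = [0, k₁−1] and P₂ = [k₁+ℓ₁, k₁+ℓ₁+k₂−1] be two disjoint integer segments of lengths k₁, k₂ ≥ 1 separated by a gap of length ℓ₁ ≥ 1. If max(k₁, k₂) < ℓ₁ + 2, then the three sumsets 2P₁, P₁+P₂ and 2P₂ are pairwise disjoint. If max(k₁, k₂) ≥ ℓ₁ + 2, then the set P₁ ∪ P₂ is 1-dimensional and 2(P₁ ∪ P₂) equals the full interval [0, 2(k₁+ℓ₁+k₂−1)] with one interval of consecutive integers removed, of length max{ℓ₁ − min(k₁,k₂) + 1, 0}. -/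
open Pointwise

theorem Int.mem_Icc_add_Icc {a b c d : ℤ} (hab : a ≤ b) (hcd : c ≤ d) {x : ℤ} :
    x ∈ Finset.Icc a b + Finset.Icc c d ↔ a + c ≤ x ∧ x ≤ b + d := by
  simp only [Finset.mem_add, Finset.mem_Icc]
  constructor
  · rintro ⟨y, hy, z, hz, rfl⟩
    omega
  · intro h
    exact ⟨max a (x - d), by omega, x - max a (x - d), by omega, by omega⟩

/-- A Freiman homomorphism on two segments, the first of which is longer than the gap by at
least two, vanishes as soon as it vanishes at the first two points. -/
theorem freimanHom_eq_zero_of_long_left {M : Type*} [AddCommGroup M] {k₁ k₂ l : ℕ}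
    (hk : l + 2 ≤ k₁) (hl : 1 ≤ l) {A : Finset ℤ}
    (hA : ∀ x : ℤ, x ∈ A ↔ (0 ≤ x ∧ x < k₁) ∨ ((k₁ : ℤ) + l ≤ x ∧ x < (k₁ : ℤ) + l + k₂))
    {g : ℤ → M}
    (hg : ∀ x ∈ A, ∀ y ∈ A, ∀ z ∈ A, ∀ t ∈ A, x + y = z + t → g x + g y = g z + g t)
    (h0 : g 0 = 0) (h1 : g 1 = 0) : ∀ x ∈ A, g x = 0 := by
  suffices H : ∀ n : ℕ, (n : ℤ) ∈ A → g n = 0 by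
    intro x hx
    obtain ⟨n, rfl⟩ := Int.eq_ofNat_of_zero_le (show 0 ≤ x by have := (hA x).1 hx; omega)
    exact H n hx
  intro n
  induction n using Nat.strong_induction_on with
  | _ n ih =>
    intro hn
    have key : ∀ y z t : ℕ, y < n → z < n → t < n → (y : ℤ) ∈ A → (z : ℤ) ∈ A →
        (t : ℤ) ∈ A → n + y = z + t → g n = 0 := by
      intro y z t hyn hzn htn hy hz ht h
      have := hg n hn y hy z hz t ht (by exact_mod_cast h)
      simpa [ih y hyn hy, ih z hzn hz, ih t htn ht] using this
    simp only [hA] at hn key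
    rcases lt_or_ge n 2 with h | h
    · interval_cases n
      · simpa using h0
      · simpa using h1
    rcases lt_or_ge n k₁ with h' | h'
    · exact key (n - 2) (n - 1) (n - 1) (by omega) (by omega) (by omega) (by omega)
        (by omega) (by omega) (by omega)
    rcases eq_or_ne n (k₁ + l) with h'' | h''
    · exact key (k₁ - l - 2) (k₁ - 1) (k₁ - 1) (by omega) (by omega) (by omega) (by omega)
        (by omega) (by omega) (by omega)
    · exact key 0 (n - 1) 1 (by omega) (by omega) (by omega) (by omega)
        (by omega) (by omega) (by omega)

theorem freimanHom_affine_of_long_left {M : Type*} [AddCommGroup M] {k₁ k₂ l : ℕ}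
    (hk : l + 2 ≤ k₁) (hl : 1 ≤ l) {A : Finset ℤ}
    (hA : ∀ x : ℤ, x ∈ A ↔ (0 ≤ x ∧ x < k₁) ∨ ((k₁ : ℤ) + l ≤ x ∧ x < (k₁ : ℤ) + l + k₂))
    {φ : ℤ → M}
    (hφ : ∀ x ∈ A, ∀ y ∈ A, ∀ z ∈ A, ∀ t ∈ A, x + y = z + t → φ x + φ y = φ z + φ t) :
    ∃ p v : M, ∀ x ∈ A, φ x = p + x • v := by
  refine ⟨φ 0, φ 1 - φ 0, fun x hx => ?_⟩
  have := freimanHom_eq_zero_of_long_left hk hl hA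
    (g := fun x => φ x - (φ 0 + x • (φ 1 - φ 0))) ?_ (by simp) (by simp) x hx
  · exact sub_eq_zero.1 this
  · intro x hx y hy z hz t ht h
    rw [sub_add_sub_comm, sub_add_sub_comm, hφ x hx y hy z hz t ht h,
      add_add_add_comm, add_add_add_comm (φ 0) (z • _), ← add_smul, ← add_smul, h]

theorem freimanHom_affine {M : Type*} [AddCommGroup M] {k₁ k₂ l : ℕ}
    (hk : l + 2 ≤ max k₁ k₂) (hl : 1 ≤ l) {A : Finset ℤ}
    (hA : ∀ x : ℤ, x ∈ A ↔ (0 ≤ x ∧ x < k₁) ∨ ((k₁ : ℤ) + l ≤ x ∧ x < (k₁ : ℤ) + l + k₂))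
    {φ : ℤ → M}
    (hφ : ∀ x ∈ A, ∀ y ∈ A, ∀ z ∈ A, ∀ t ∈ A, x + y = z + t → φ x + φ y = φ z + φ t) :
    ∃ p v : M, ∀ x ∈ A, φ x = p + x • v := by
  rcases le_max_iff.1 hk with hk | hk
  · exact freimanHom_affine_of_long_left hk hl hA hφ
  set N : ℤ := (k₁ : ℤ) + l + k₂ - 1 with hN
  have hmem : ∀ x : ℤ, x ∈ A.image (N - ·) ↔ N - x ∈ A := by
    intro x
    simp only [Finset.mem_image]
    constructor
    · rintro ⟨y, hy, rfl⟩
      simpa using hy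
    · exact fun h => ⟨N - x, h, by ring⟩
  obtain ⟨p, v, h⟩ := freimanHom_affine_of_long_left (k₁ := k₂) (k₂ := k₁) (l := l)
    (A := A.image (N - ·)) (φ := fun x => φ (N - x)) hk hl
    (fun x => by rw [hmem, hA]; omega)
    (fun x hx y hy z hz t ht h => hφ _ ((hmem x).1 hx) _ ((hmem y).1 hy) _ ((hmem z).1 hz) _
      ((hmem t).1 ht) (by linarith))
  refine ⟨p + N • v, -v, fun x hx => ?_⟩
  have := h (N - x) ((hmem _).2 (by simpa using hx))
  simp only [sub_sub_cancel] at this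
  rw [this, sub_smul, smul_neg]
  abel

theorem NotInAffineHyperplane.le_one_of_subset_line {d : ℕ} {B : Finset (Fin d → ℤ)}
    (hB : NotInAffineHyperplane B) (p v : Fin d → ℤ) (h : ∀ y ∈ B, ∃ n : ℤ, y = p + n • v) :
    d ≤ 1 := by
  by_contra! hd
  have main : ∀ c : Fin d → ℤ, c ⬝ᵥ v = 0 → c = 0 := by
    intro c hc
    refine hB c (c ⬝ᵥ p) fun y hy => ?_
    obtain ⟨n, rfl⟩ := h y hy
    change c ⬝ᵥ (p + n • v) = c ⬝ᵥ p
    rw [dotProduct_add, dotProduct_smul, hc, smul_zero, add_zero]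
  let i : Fin d := ⟨0, by omega⟩
  let j : Fin d := ⟨1, by omega⟩
  have hij : i ≠ j := by simp [i, j, Fin.ext_iff]
  have h1 := main (Pi.single i (v j) - Pi.single j (v i)) (by
    rw [sub_dotProduct, single_dotProduct, single_dotProduct]
    ring)
  have hvj : v j = 0 := by simpa [hij] using congrFun h1 i
  have h2 := congrFun (main (Pi.single j 1) (by simp [hvj])) j
  simp at h2

theorem hasFullDimWitness_one {A : Finset ℤ} {a b : ℤ} (ha : a ∈ A) (hb : b ∈ A)
    (hab : a ≠ b) : HasFullDimWitness A 1 := by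
  classical
  refine ⟨A.image fun x _ => x, ⟨fun x _ => x, ⟨?_, ?_, ?_⟩, ?_⟩, ?_⟩
  · exact fun x hx => Finset.mem_image_of_mem _ hx
  · intro x _ y _ h
    exact congrFun h 0
  · intro y hy
    simpa using hy
  · intro x _ y _ z _ t _
    exact ⟨fun h => funext fun _ => h, fun h => congrFun h 0⟩
  · intro c t h
    have h1 := h _ (Finset.mem_image_of_mem _ ha)
    have h2 := h _ (Finset.mem_image_of_mem _ hb)
    simp only [Fin.sum_univ_one, Fin.isValue] at h1 h2
    have h3 : c 0 * (a - b) = 0 := by linarith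
    ext i
    rw [Subsingleton.elim i 0]
    exact (mul_eq_zero.1 h3).resolve_right (sub_ne_zero.2 hab)

/-- Claim 4.5: dichotomy for the doubling of a union of two segments. -/
theorem two_segments_claim (k₁ k₂ ℓ₁ : ℕ) (hk₁ : 1 ≤ k₁) (hk₂ : 1 ≤ k₂) (hℓ : 1 ≤ ℓ₁)
    (P₁ P₂ : Finset ℤ)
    (hP₁ : P₁ = Finset.Icc (0 : ℤ) ((k₁ : ℤ) - 1))
    (hP₂ : P₂ = Finset.Icc ((k₁ : ℤ) + ℓ₁) ((k₁ : ℤ) + ℓ₁ + k₂ - 1)) :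
    (max k₁ k₂ < ℓ₁ + 2 →
      Disjoint (P₁ + P₁) (P₁ + P₂) ∧ Disjoint (P₁ + P₁) (P₂ + P₂) ∧
        Disjoint (P₁ + P₂) (P₂ + P₂)) ∧
    (ℓ₁ + 2 ≤ max k₁ k₂ →
      HasAddDim (P₁ ∪ P₂) 1 ∧
      ∃ u v : ℤ, (P₁ ∪ P₂) + (P₁ ∪ P₂) =
          Finset.Icc (0 : ℤ) (2 * ((k₁ : ℤ) + ℓ₁ + k₂ - 1)) \ Finset.Icc u v ∧
        ((Finset.Icc u v).card : ℤ) = max ((ℓ₁ : ℤ) - (min k₁ k₂ : ℕ) + 1) 0) := by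
  have memA : ∀ x : ℤ, x ∈ P₁ ∪ P₂ ↔
      (0 ≤ x ∧ x < k₁) ∨ ((k₁ : ℤ) + ℓ₁ ≤ x ∧ x < (k₁ : ℤ) + ℓ₁ + k₂) := by
    intro x
    rw [Finset.mem_union, hP₁, hP₂, Finset.mem_Icc, Finset.mem_Icc]
    omega
  have m11 : ∀ x : ℤ, x ∈ P₁ + P₁ ↔
      0 + 0 ≤ x ∧ x ≤ ((k₁ : ℤ) - 1) + ((k₁ : ℤ) - 1) := fun x => by
    rw [hP₁]
    exact Int.mem_Icc_add_Icc (by omega) (by omega)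
  have m12 : ∀ x : ℤ, x ∈ P₁ + P₂ ↔
      0 + ((k₁ : ℤ) + ℓ₁) ≤ x ∧ x ≤ ((k₁ : ℤ) - 1) + ((k₁ : ℤ) + ℓ₁ + k₂ - 1) := fun x => by
    rw [hP₁, hP₂]
    exact Int.mem_Icc_add_Icc (by omega) (by omega)
  have m22 : ∀ x : ℤ, x ∈ P₂ + P₂ ↔
      ((k₁ : ℤ) + ℓ₁) + ((k₁ : ℤ) + ℓ₁) ≤ x ∧ x ≤ ((k₁ : ℤ) + ℓ₁ + k₂ - 1) + ((k₁ : ℤ) + ℓ₁ + k₂ - 1) := fun x => by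
    rw [hP₂]
    exact Int.mem_Icc_add_Icc (by omega) (by omega)
  refine ⟨fun h => ?_, fun h => ⟨⟨?_, ?_⟩, ?_⟩⟩
  · simp only [Finset.disjoint_left, m11, m12, m22]
    refine ⟨?_, ?_, ?_⟩ <;> intro x hx <;> omega
  · exact hasFullDimWitness_one ((memA 0).2 (by omega)) ((memA (k₁ + ℓ₁)).2 (by omega))
      (by omega)
  · rintro d ⟨B, ⟨φ, hbij, hφ⟩, hB⟩
    obtain ⟨p, v, hpv⟩ := freimanHom_affine h hℓ memA
      fun x hx y hy z hz t ht => (hφ x hx y hy z hz t ht).1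
    refine hB.le_one_of_subset_line p v fun y hy => ?_
    obtain ⟨x, hx, rfl⟩ := hbij.surjOn hy
    exact ⟨x, hpv x hx⟩
  · have hsum : ∀ x : ℤ, x ∈ (P₁ ∪ P₂) + (P₁ ∪ P₂) ↔
        x ∈ P₁ + P₁ ∨ x ∈ P₁ + P₂ ∨ x ∈ P₂ + P₂ := by
      intro x
      rw [Finset.union_add, Finset.add_union, Finset.add_union, add_comm P₂ P₁]
      simp only [Finset.mem_union]
      tauto
    rcases le_max_iff.1 h with h | h
    · refine ⟨2 * k₁ + ℓ₁ + k₂ - 1, 2 * k₁ + 2 * ℓ₁ - 1, ?_, ?_⟩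
      · ext x
        rw [hsum, m11, m12, m22, Finset.mem_sdiff, Finset.mem_Icc, Finset.mem_Icc]
        omega
      · rw [Int.card_Icc]
        omega
    · refine ⟨2 * k₁ - 1, k₁ + ℓ₁ - 1, ?_, ?_⟩
      · ext x
        rw [hsum, m11, m12, m22, Finset.mem_sdiff, Finset.mem_Icc, Finset.mem_Icc]
        omega
      · rw [Int.card_Icc]
        omega
end

section
/- Let k ≥ 4 and 1 ≤ b ≤ k − 3 be integers and let A = ([0, k+b−2] \ [1, b]) ∪ {2(k+b−2)} ⊆ ℤ, i.e. A = {0} ∪ [b+1, k+b−2] ∪ {2(k+b−2)}. Then |A| = k and |2A| = 3k − 4 + b. -/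
open Pointwise

/-- The set `{0} ∪ [b+1, N] ∪ {2N}` has doubling `{0} ∪ [b+1, 2N] ∪ [2N+b+1, 3N] ∪ {4N}`
as soon as `2b + 1 ≤ N`. -/
lemma insert_Icc_sdiff_Icc_add_self (N b : ℤ) (hb : 0 ≤ b) (hN : 2 * b + 1 ≤ N) :
    insert (2 * N) (Finset.Icc 0 N \ Finset.Icc 1 b) +
        insert (2 * N) (Finset.Icc 0 N \ Finset.Icc 1 b) =
      insert 0 (insert (4 * N)
        (Finset.Icc (b + 1) (2 * N) ∪ Finset.Icc (2 * N + b + 1) (3 * N))) := by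
  ext x
  simp only [Finset.mem_add, Finset.mem_insert, Finset.mem_union, Finset.mem_sdiff,
    Finset.mem_Icc]
  constructor
  · rintro ⟨y, hy, z, hz, rfl⟩
    omega
  · rintro (rfl | rfl | h | h)
    · exact ⟨0, by omega, 0, by omega, by omega⟩
    · exact ⟨2 * N, by omega, 2 * N, by omega, by omega⟩
    · by_cases h₁ : x ≤ N
      · exact ⟨0, by omega, x, by omega, by omega⟩
      by_cases h₂ : x ≤ N + b + 1
      · exact ⟨b + 1, by omega, x - (b + 1), by omega, by omega⟩
      · exact ⟨N, by omega, x - N, by omega, by omega⟩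
    · exact ⟨2 * N, by omega, x - 2 * N, by omega, by omega⟩

/-- Case (i) of Theorem 1.3: cardinality and doubling of
`A = ([0,k+b-2] \ [1,b]) ∪ {2(k+b-2)}`. -/
theorem card_doubling_case_i (k b : ℕ) (hk : 4 ≤ k) (hb1 : 1 ≤ b) (hbk : b + 3 ≤ k)
    (A : Finset ℤ)
    (hA : A = insert (2 * ((k : ℤ) + b - 2))
      (Finset.Icc (0 : ℤ) ((k : ℤ) + b - 2) \ Finset.Icc (1 : ℤ) (b : ℤ))) :
    A.card = k ∧ (A + A).card = 3 * k - 4 + b := by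
  subst hA
  constructor
  · rw [Finset.card_insert_of_notMem (by simp only [Finset.mem_sdiff, Finset.mem_Icc]; omega),
      Finset.card_sdiff_of_subset (Finset.Icc_subset_Icc (by omega) (by omega)),
      Int.card_Icc, Int.card_Icc]
    omega
  · rw [insert_Icc_sdiff_Icc_add_self _ _ (by omega) (by omega),
      Finset.card_insert_of_notMem (by
        simp only [Finset.mem_insert, Finset.mem_union, Finset.mem_Icc]; omega),
      Finset.card_insert_of_notMem (by simp only [Finset.mem_union, Finset.mem_Icc]; omega),
      Finset.card_union_of_disjoint (by
        rw [Finset.disjoint_left]; intro x; simp only [Finset.mem_Icc]; omega),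
      Int.card_Icc, Int.card_Icc]
    omega
end

section
/- Let k, i, b be integers with i ≥ 1, 3i ≤ k, 2 ≤ b ≤ k − 2i − 1, and let A = ([0, k+b+i−3] \ [k−i−1, k+b−3]) ∪ {2(k+b−2)} ⊆ ℤ, i.e. A = [0, k−i−2] ∪ [k+b−2, k+b+i−3] ∪ {2(k+b−2)}. Then |A| = k and |2A| = 3k − 4 + b. -/
open Pointwise

/-- Every integer of `[a + c, b + d]` is the sum of an element of `[a, b]` and one of `[c, d]`. -/
theorem Int.exists_add_eq_of_bounds {a b c d x : ℤ} (hab : a ≤ b) (hcd : c ≤ d)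
    (hx₁ : a + c ≤ x) (hx₂ : x ≤ b + d) :
    ∃ y z : ℤ, (a ≤ y ∧ y ≤ b) ∧ (c ≤ z ∧ z ≤ d) ∧ y + z = x :=
  ⟨min b (x - c), x - min b (x - c), by omega, by omega, by omega⟩

/-- Case (ii) of Theorem 1.3: cardinality and doubling of
`A = ([0,k+b+i-3] \ [k-i-1,k+b-3]) ∪ {2(k+b-2)}`. -/
theorem card_doubling_case_ii (k i b : ℕ) (hi : 1 ≤ i) (hik : 3 * i ≤ k)
    (hb2 : 2 ≤ b) (hbk : b + 2 * i + 1 ≤ k)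
    (A : Finset ℤ)
    (hA : A = insert (2 * ((k : ℤ) + b - 2))
      (Finset.Icc (0 : ℤ) ((k : ℤ) + b + i - 3) \
        Finset.Icc ((k : ℤ) - i - 1) ((k : ℤ) + b - 3))) :
    A.card = k ∧ (A + A).card = 3 * k - 4 + b := by
  obtain ⟨M, hM⟩ : ∃ M : ℤ, M = k + b - 2 := ⟨_, rfl⟩
  have mem_A (x : ℤ) : x ∈ A ↔
      (0 ≤ x ∧ x ≤ k - i - 2) ∨ (M ≤ x ∧ x ≤ M + i - 1) ∨ x = 2 * M := by
    simp only [hA, Finset.mem_insert, Finset.mem_sdiff, Finset.mem_Icc]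
    omega
  have hA' : A = Finset.Icc 0 ((k : ℤ) - i - 2) ∪
      (Finset.Icc M (M + i - 1) ∪ Finset.Icc (2 * M) (2 * M)) := by
    ext x
    simp only [mem_A, Finset.mem_union, Finset.mem_Icc]
    omega
  have hAA : A + A = Finset.Icc 0 (M + k - 3) ∪ (Finset.Icc (2 * M) (2 * M + k - i - 2) ∪
      (Finset.Icc (3 * M) (3 * M + i - 1) ∪ Finset.Icc (4 * M) (4 * M))) := by
    ext x
    simp only [Finset.mem_add, mem_A, Finset.mem_union, Finset.mem_Icc]
    constructor
    · rintro ⟨y, hy, z, hz, rfl⟩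
      omega
    · rintro (⟨h₁, h₂⟩ | ⟨h₁, h₂⟩ | ⟨h₁, h₂⟩ | ⟨h₁, h₂⟩)
      · by_cases hx : x < M
        · obtain ⟨y, z, hy, hz, h⟩ := Int.exists_add_eq_of_bounds
            (a := 0) (b := (k : ℤ) - i - 2) (c := 0) (d := (k : ℤ) - i - 2) (x := x)
            (by omega) (by omega) (by omega) (by omega)
          exact ⟨y, Or.inl hy, z, Or.inl hz, h⟩
        · obtain ⟨y, z, hy, hz, h⟩ := Int.exists_add_eq_of_bounds
            (a := 0) (b := (k : ℤ) - i - 2) (c := M) (d := M + i - 1) (x := x)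
            (by omega) (by omega) (by omega) (by omega)
          exact ⟨y, Or.inl hy, z, Or.inr (Or.inl hz), h⟩
      · exact ⟨x - 2 * M, by omega, 2 * M, by omega, by omega⟩
      · exact ⟨x - 2 * M, by omega, 2 * M, by omega, by omega⟩
      · exact ⟨2 * M, by omega, 2 * M, by omega, by omega⟩
  constructor
  · rw [hA', Finset.card_union_of_disjoint, Finset.card_union_of_disjoint]
    · simp only [Int.card_Icc]
      omega
    all_goals
      simp only [Finset.disjoint_left, Finset.mem_union, Finset.mem_Icc]
      intros
      omega
  · rw [hAA, Finset.card_union_of_disjoint, Finset.card_union_of_disjoint,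
      Finset.card_union_of_disjoint]
    · simp only [Int.card_Icc]
      omega
    all_goals
      simp only [Finset.disjoint_left, Finset.mem_union, Finset.mem_Icc]
      intros
      omega
end

section
/- Let k ≥ 4 and 1 ≤ b ≤ k − 3 be integers and let A = (([0, k+b−2] \ [1, b]) × {0}) ∪ {(0, 1)} ⊆ ℤ², i.e. A = (({0} ∪ [b+1, k+b−2]) × {0}) ∪ {(0,1)}. Then |A| = k and |2A| = 3k − 3 + b. -/
open Pointwise

/-- Adjoining one point at height `1` to a planar copy of `S` at height `0` gives a set whose
sumset splits into the three layers `S + S`, `S` and a single point. -/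
theorem card_add_self_product_union_singleton (S : Finset ℤ) :
    ((S ×ˢ {0} ∪ {((0 : ℤ), (1 : ℤ))}) + (S ×ˢ {0} ∪ {((0 : ℤ), (1 : ℤ))})).card =
      (S + S).card + S.card + 1 := by
  have h : (S ×ˢ {0} ∪ {((0 : ℤ), (1 : ℤ))}) + (S ×ˢ {0} ∪ {((0 : ℤ), (1 : ℤ))}) =
      ((S + S) ×ˢ {0} ∪ S ×ˢ {1}) ∪ {((0 : ℤ), (2 : ℤ))} := by
    ext ⟨x, y⟩
    simp only [Finset.mem_add, Finset.mem_union, Finset.mem_product, Finset.mem_singleton,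
      Prod.exists, Prod.mk_add_mk, Prod.mk.injEq]
    constructor
    · rintro ⟨a, c, ⟨ha, rfl⟩ | ⟨rfl, rfl⟩, d, e, ⟨hd, rfl⟩ | ⟨rfl, rfl⟩, rfl, rfl⟩
      · exact Or.inl (Or.inl ⟨⟨a, ha, d, hd, rfl⟩, by norm_num⟩)
      · exact Or.inl (Or.inr ⟨by simpa using ha, by norm_num⟩)
      · exact Or.inl (Or.inr ⟨by simpa using hd, by norm_num⟩)
      · exact Or.inr ⟨by norm_num, by norm_num⟩
    · rintro ((⟨⟨a, ha, d, hd, rfl⟩, rfl⟩ | ⟨hx, rfl⟩) | ⟨rfl, rfl⟩)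
      · exact ⟨a, 0, Or.inl ⟨ha, rfl⟩, d, 0, Or.inl ⟨hd, rfl⟩, rfl, by norm_num⟩
      · exact ⟨x, 0, Or.inl ⟨hx, rfl⟩, 0, 1, Or.inr ⟨rfl, rfl⟩, by norm_num, by norm_num⟩
      · exact ⟨0, 1, Or.inr ⟨rfl, rfl⟩, 0, 1, Or.inr ⟨rfl, rfl⟩, by norm_num, by norm_num⟩
  rw [h, Finset.card_union_of_disjoint, Finset.card_union_of_disjoint]
  · simp
  · simp +contextual [Finset.disjoint_left]
  · simp

/-- If `2p ≤ q + 1`, doubling `{0} ∪ [p, q]` leaves only the hole between `0` and `p`. -/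
theorem insert_zero_Icc_add_self {p q : ℤ} (hp : 0 < p) (hpq : 2 * p ≤ q + 1) :
    insert 0 (Finset.Icc p q) + insert 0 (Finset.Icc p q) =
      insert 0 (Finset.Icc p (2 * q)) := by
  ext n
  simp only [Finset.mem_add, Finset.mem_insert, Finset.mem_Icc]
  constructor
  · rintro ⟨a, ha, c, hc, rfl⟩
    omega
  · intro hn
    by_cases hnq : n ≤ q
    · exact ⟨0, Or.inl rfl, n, by omega, by omega⟩
    · exact ⟨max p (n - q), by omega, n - max p (n - q), by omega, by omega⟩

/-- Case (iii) of Theorem 1.3: cardinality and doubling of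
`A = (([0,k+b-2] \ [1,b]) × {0}) ∪ {(0,1)} ⊆ ℤ²`. -/
theorem card_doubling_case_iii (k b : ℕ) (hk : 4 ≤ k) (hb1 : 1 ≤ b) (hbk : b + 3 ≤ k)
    (A : Finset (ℤ × ℤ))
    (hA : A = ((Finset.Icc (0 : ℤ) ((k : ℤ) + b - 2) \ Finset.Icc (1 : ℤ) (b : ℤ)).image
      (fun t => (t, (0 : ℤ)))) ∪ {((0 : ℤ), (1 : ℤ))}) :
    A.card = k ∧ (A + A).card = 3 * k - 3 + b := by
  have hS : Finset.Icc (0 : ℤ) ((k : ℤ) + b - 2) \ Finset.Icc (1 : ℤ) (b : ℤ) =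
      insert 0 (Finset.Icc ((b : ℤ) + 1) ((k : ℤ) + b - 2)) := by
    ext x
    simp only [Finset.mem_sdiff, Finset.mem_Icc, Finset.mem_insert]
    omega
  have hcard (q : ℤ) : (insert 0 (Finset.Icc ((b : ℤ) + 1) q)).card = (q - b).toNat + 1 := by
    rw [Finset.card_insert_of_notMem (by simp), Int.card_Icc]
    congr 2
    ring
  have hprod (S : Finset ℤ) : S.image (fun t => (t, (0 : ℤ))) = S ×ˢ {0} := by
    rw [Finset.product_singleton, Finset.map_eq_image]
    rfl
  rw [hS, hprod] at hA
  subst hA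
  refine ⟨?_, ?_⟩
  · rw [Finset.card_union_of_disjoint (by simp), Finset.card_product, hcard]
    simp only [Finset.card_singleton]
    omega
  · rw [card_add_self_product_union_singleton,
      insert_zero_Icc_add_self (by omega) (by omega), hcard, hcard]
    omega
end

section
/- Let k₁, k₂, k₃ ≥ 1 be integers and let A = ([0, k₁−1] × {(0,0)}) ∪ ([0, k₂−1] × {(0,1)}) ∪ ([0, k₃−1] × {(1,0)}) ⊆ ℤ³. Then |A| = k₁ + k₂ + k₃ and |2A| = 4(k₁ + k₂ + k₃) − 6. -/
open Pointwise

/-- The lattice segment `[0, n] × {p}`. -/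
noncomputable def latticeSegment (n : ℤ) (p : ℤ × ℤ) : Finset (ℤ × ℤ × ℤ) :=
  (Finset.Icc 0 n).image fun t => (t, p)

theorem mem_latticeSegment {n : ℤ} {p : ℤ × ℤ} {x : ℤ × ℤ × ℤ} :
    x ∈ latticeSegment n p ↔ (0 ≤ x.1 ∧ x.1 ≤ n) ∧ x.2 = p := by
  simp only [latticeSegment, Finset.mem_image, Finset.mem_Icc]
  constructor
  · rintro ⟨t, ht, rfl⟩
    exact ⟨ht, rfl⟩
  · rintro ⟨hx, rfl⟩
    exact ⟨x.1, hx, rfl⟩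

theorem card_latticeSegment (n : ℤ) (p : ℤ × ℤ) :
    (latticeSegment n p).card = (n + 1).toNat := by
  rw [latticeSegment, Finset.card_image_of_injective _ fun a b h => congrArg Prod.fst h,
    Int.card_Icc, sub_zero]

theorem disjoint_latticeSegment (m n : ℤ) {p q : ℤ × ℤ} (h : p ≠ q) :
    Disjoint (latticeSegment m p) (latticeSegment n q) := by
  rw [Finset.disjoint_left]
  intro x hx hy
  exact h ((mem_latticeSegment.1 hx).2.symm.trans (mem_latticeSegment.1 hy).2)

theorem latticeSegment_add {m n : ℤ} (hm : 0 ≤ m) (hn : 0 ≤ n) (p q : ℤ × ℤ) :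
    latticeSegment m p + latticeSegment n q = latticeSegment (m + n) (p + q) := by
  ext ⟨t, r⟩
  simp only [Finset.mem_add, mem_latticeSegment]
  constructor
  · rintro ⟨⟨a, _⟩, ⟨ha, rfl⟩, ⟨b, _⟩, ⟨hb, rfl⟩, h⟩
    simp only [Prod.mk_add_mk, Prod.mk.injEq] at h ha hb
    exact ⟨by constructor <;> omega, h.2.symm⟩
  · rintro ⟨ht, rfl⟩
    refine ⟨(min t m, p), ⟨by constructor <;> omega, rfl⟩,
      (t - min t m, q), ⟨by constructor <;> omega, rfl⟩, ?_⟩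
    simp

/-- The sumset of a union of three sets, with repeated sums merged. -/
theorem union_three_add_self {G : Type*} [AddCommMonoid G] [DecidableEq G] (P Q R : Finset G) :
    (P ∪ Q ∪ R) + (P ∪ Q ∪ R) =
      (P + P) ∪ (Q + Q) ∪ (R + R) ∪ (P + Q) ∪ (P + R) ∪ (Q + R) := by
  simp only [Finset.union_add, Finset.add_union, add_comm Q P, add_comm R P, add_comm R Q]
  ext x
  simp only [Finset.mem_union]
  tauto

/-- Case (iv) of Theorem 1.3: cardinality and doubling of three parallel segments in `ℤ³`. -/
theorem card_doubling_case_iv (k₁ k₂ k₃ : ℕ) (h₁ : 1 ≤ k₁) (h₂ : 1 ≤ k₂) (h₃ : 1 ≤ k₃)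
    (A : Finset (ℤ × ℤ × ℤ))
    (hA : A = ((Finset.Icc (0 : ℤ) ((k₁ : ℤ) - 1)).image (fun t => (t, (0 : ℤ), (0 : ℤ)))) ∪
              ((Finset.Icc (0 : ℤ) ((k₂ : ℤ) - 1)).image (fun t => (t, (0 : ℤ), (1 : ℤ)))) ∪
              ((Finset.Icc (0 : ℤ) ((k₃ : ℤ) - 1)).image (fun t => (t, (1 : ℤ), (0 : ℤ))))) :
    A.card = k₁ + k₂ + k₃ ∧ (A + A).card = 4 * (k₁ + k₂ + k₃) - 6 := by
  change A = latticeSegment (k₁ - 1) (0, 0) ∪ latticeSegment (k₂ - 1) (0, 1) ∪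
    latticeSegment (k₃ - 1) (1, 0) at hA
  have hA2 := union_three_add_self (latticeSegment (k₁ - 1) (0, 0))
    (latticeSegment (k₂ - 1) (0, 1)) (latticeSegment (k₃ - 1) (1, 0))
  rw [← hA, latticeSegment_add (by omega) (by omega), latticeSegment_add (by omega) (by omega),
    latticeSegment_add (by omega) (by omega), latticeSegment_add (by omega) (by omega),
    latticeSegment_add (by omega) (by omega), latticeSegment_add (by omega) (by omega)] at hA2
  constructor
  · rw [hA]
    repeat rw [Finset.card_union_of_disjoint (by
      try simp only [Finset.disjoint_union_left]
      repeat' apply And.intro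
      all_goals exact disjoint_latticeSegment _ _ (by decide))]
    simp only [card_latticeSegment]
    omega
  · rw [hA2]
    repeat rw [Finset.card_union_of_disjoint (by
      try simp only [Finset.disjoint_union_left]
      repeat' apply And.intro
      all_goals exact disjoint_latticeSegment _ _ (by decide))]
    simp only [card_latticeSegment]
    omega
end

section
/- Let k ≥ 3 and 1 ≤ b ≤ k − 2 be integers and let A = [0, k+b−1] \ [1, b] ⊆ ℤ, i.e. A = {0} ∪ [b+1, k+b−1]. Then |A| = k and |2A| = 2k − 1 + b. -/
open Pointwise

/-- The set `{0} ∪ [l, m]` has cardinality `m + 2 - l` when `0 < l ≤ m + 1`. -/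
theorem card_insert_zero_Icc {l m : ℤ} (hl : 0 < l) (hlm : l ≤ m + 1) :
    ((insert 0 (Finset.Icc l m)).card : ℤ) = m + 2 - l := by
  rw [Finset.card_insert_of_notMem (by simp [hl]), Int.card_Icc]
  omega

/-- If `0 < l` and `2 * l ≤ m + 1`, then the sumset of `{0} ∪ [l, m]` is `{0} ∪ [l, 2m]`. -/
theorem insert_zero_Icc_add_self_s16 {l m : ℤ} (hl : 0 < l) (hlm : 2 * l ≤ m + 1) :
    insert 0 (Finset.Icc l m) + insert 0 (Finset.Icc l m) =
      insert 0 (Finset.Icc l (2 * m)) := by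
  ext x
  simp only [Finset.mem_add, Finset.mem_insert, Finset.mem_Icc]
  constructor
  · rintro ⟨y, hy, z, hz, rfl⟩
    omega
  · intro hx
    by_cases hxm : x ≤ m
    · exact ⟨0, by omega, x, by omega, by omega⟩
    · by_cases hxl : x ≤ m + l
      · exact ⟨l, by omega, x - l, by omega, by omega⟩
      · exact ⟨m, by omega, x - m, by omega, by omega⟩

/-- Case (i) of Lemma 4.4: cardinality and doubling of `A = [0,k+b-1] \ [1,b]`. -/
theorem card_doubling_lemma_case_i (k b : ℕ) (hk : 3 ≤ k) (hb1 : 1 ≤ b) (hbk : b + 2 ≤ k)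
    (A : Finset ℤ)
    (hA : A = Finset.Icc (0 : ℤ) ((k : ℤ) + b - 1) \ Finset.Icc (1 : ℤ) (b : ℤ)) :
    A.card = k ∧ (A + A).card = 2 * k - 1 + b := by
  have hA' : A = insert 0 (Finset.Icc ((b : ℤ) + 1) ((k : ℤ) + b - 1)) := by
    ext x
    simp only [hA, Finset.mem_sdiff, Finset.mem_insert, Finset.mem_Icc]
    omega
  have hcard := card_insert_zero_Icc (l := (b : ℤ) + 1) (m := (k : ℤ) + b - 1)
    (by omega) (by omega)
  have hcard_add := card_insert_zero_Icc (l := (b : ℤ) + 1) (m := 2 * ((k : ℤ) + b - 1))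
    (by omega) (by omega)
  rw [← insert_zero_Icc_add_self_s16 (by omega) (by omega), ← hA'] at hcard_add
  rw [← hA'] at hcard
  omega
end

section
/- Let A = P₁ ∪ P₂ ⊆ ℤ be the union of two disjoint segments P₁ < P₂ such that the three sumsets 2P₁, P₁ + P₂ and 2P₂ are pairwise disjoint. Then the additive dimension of A equals 2. -/
open Pointwise

/-- Any two vectors of `ℤ^d`, `d > 2`, have a common nonzero orthogonal integer vector. -/
lemma exists_ne_zero_orthogonal_pair {d : ℕ} (hd : 2 < d) (u w : Fin d → ℤ) :
    ∃ c : Fin d → ℤ, c ≠ 0 ∧ ∑ i, c i * u i = 0 ∧ ∑ i, c i * w i = 0 := by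
  by_contra! h
  refine absurd (le_of_fin_injective ℤ (Matrix.mulVecLin (Matrix.of ![u, w])) ?_) hd.not_ge
  rw [injective_iff_map_eq_zero]
  intro c hc
  by_contra hne
  have h0 := congrFun hc 0
  have h1 := congrFun hc 1
  simp only [Matrix.mulVecLin_apply, Matrix.mulVec, dotProduct, Matrix.of_apply,
    Matrix.cons_val_zero, Matrix.cons_val_one, Pi.zero_apply] at h0 h1
  exact h c hne (by simpa only [mul_comm] using h0) (by simpa only [mul_comm] using h1)

/-- A function on an integer interval with zero increments is constant. -/
lemma eq_left_of_forall_succ_eq {M : Type*} (f : ℤ → M) {a b : ℤ}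
    (h : ∀ x, a ≤ x → x + 1 ≤ b → f (x + 1) = f x) {x : ℤ} (hax : a ≤ x) (hxb : x ≤ b) :
    f x = f a := by
  induction x, hax using Int.leInduction with
  | base => rfl
  | succ n hn ih => rw [h n hn hxb, ih (by omega)]

/-- A map preserving additive quadruples has the same increment at any two pairs of
consecutive elements. -/
lemma exists_forall_succ_sub_eq {G : Type*} [AddCommGroup G] (A : Finset ℤ) (φ : ℤ → G)
    (hφ : ∀ x ∈ A, ∀ y ∈ A, ∀ z ∈ A, ∀ t ∈ A,
      (x + y = z + t ↔ φ x + φ y = φ z + φ t)) :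
    ∃ u : G, ∀ x ∈ A, x + 1 ∈ A → φ (x + 1) = φ x + u := by
  by_cases h : ∃ y ∈ A, y + 1 ∈ A
  · obtain ⟨y, hy, hy1⟩ := h
    refine ⟨φ (y + 1) - φ y, fun x hx hx1 => ?_⟩
    have := (hφ (x + 1) hx1 y hy x hx (y + 1) hy1).1 (by ring)
    rw [← add_sub_assoc, ← this, add_sub_cancel_right]
  · push Not at h
    exact ⟨0, fun x hx hx1 => absurd hx1 (h x hx)⟩

/-- The dimension of a union of two integer intervals is at most two. -/
lemma HasFullDimWitness.le_two_of_Icc_union_Icc {a b c e : ℤ}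
    {d : ℕ} (h : HasFullDimWitness (Finset.Icc a b ∪ Finset.Icc c e) d) : d ≤ 2 := by
  obtain ⟨B, ⟨φ, hbij, hφ⟩, hB⟩ := h
  by_contra! hd
  obtain ⟨u, hu⟩ := exists_forall_succ_sub_eq _ φ hφ
  obtain ⟨k, hk, hku, hkw⟩ := exists_ne_zero_orthogonal_pair hd u (φ c - φ a)
  let f : ℤ → ℤ := fun x => ∑ i, k i * φ x i
  have hstep : ∀ x ∈ Finset.Icc a b ∪ Finset.Icc c e,
      x + 1 ∈ Finset.Icc a b ∪ Finset.Icc c e → f (x + 1) = f x := by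
    intro x hx hx1
    simp only [f, hu x hx hx1, Pi.add_apply, mul_add, Finset.sum_add_distrib, hku, add_zero]
  have hca : f c = f a := by
    simpa only [f, Pi.sub_apply, mul_sub, Finset.sum_sub_distrib, sub_eq_zero] using hkw
  refine hk (hB k (f a) fun v hv => ?_)
  obtain ⟨x, hx, rfl⟩ := hbij.surjOn hv
  change f x = f a
  rw [Finset.mem_coe, Finset.mem_union, Finset.mem_Icc, Finset.mem_Icc] at hx
  rcases hx with hx | hx
  · exact eq_left_of_forall_succ_eq f (fun y h1 h2 => hstep y
      (by simp only [Finset.mem_union, Finset.mem_Icc]; omega)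
      (by simp only [Finset.mem_union, Finset.mem_Icc]; omega)) hx.1 hx.2
  · rw [← hca]
    exact eq_left_of_forall_succ_eq f (fun y h1 h2 => hstep y
      (by simp only [Finset.mem_union, Finset.mem_Icc]; omega)
      (by simp only [Finset.mem_union, Finset.mem_Icc]; omega)) hx.1 hx.2

/-- If `2P`, `P + Q` and `2Q` are pairwise disjoint, then lifting `P` to height `0` and `Q` to
height `1` exhibits `P ∪ Q` as a two-dimensional set. -/
lemma hasFullDimWitness_two_of_disjoint_sums {P Q : Finset ℤ} (hP : P.Nonempty)
    (hQ : Q.Nonempty) (hPQ : Disjoint P Q) (hbig : 1 < P.card ∨ 1 < Q.card)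
    (hd1 : Disjoint (P + P) (P + Q)) (hd2 : Disjoint (P + P) (Q + Q))
    (hd3 : Disjoint (P + Q) (Q + Q)) : HasFullDimWitness (P ∪ Q) 2 := by
  classical
  let φ : ℤ → Fin 2 → ℤ := fun x => ![x, if x ∈ P then 0 else 1]
  have hφP : ∀ x ∈ P, φ x = ![x, 0] := fun x hx => by simp [φ, hx]
  have hφQ : ∀ x ∈ Q, φ x = ![x, 1] := fun x hx => by
    simp [φ, Finset.disjoint_right.1 hPQ hx]
  have hinj : Function.Injective φ := fun x y h => by simpa [φ] using congrFun h 0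
  refine ⟨(P ∪ Q).image φ, ⟨φ, ?_, ?_⟩, ?_⟩
  · rw [Finset.coe_image]
    exact hinj.injOn.bijOn_image
  · have h1 : ∀ x ∈ P, ∀ y ∈ P, ∀ z ∈ P, ∀ t ∈ Q, x + y ≠ z + t := fun x hx y hy z hz t ht h =>
      Finset.disjoint_left.1 hd1 (Finset.add_mem_add hx hy) (h ▸ Finset.add_mem_add hz ht)
    have h2 : ∀ x ∈ P, ∀ y ∈ P, ∀ z ∈ Q, ∀ t ∈ Q, x + y ≠ z + t := fun x hx y hy z hz t ht h =>
      Finset.disjoint_left.1 hd2 (Finset.add_mem_add hx hy) (h ▸ Finset.add_mem_add hz ht)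
    have h3 : ∀ x ∈ P, ∀ y ∈ Q, ∀ z ∈ Q, ∀ t ∈ Q, x + y ≠ z + t := fun x hx y hy z hz t ht h =>
      Finset.disjoint_left.1 hd3 (Finset.add_mem_add hx hy) (h ▸ Finset.add_mem_add hz ht)
    have hiff : ∀ x y z t : ℤ, φ x + φ y = φ z + φ t ↔ x + y = z + t ∧
        (if x ∈ P then (0 : ℤ) else 1) + (if y ∈ P then 0 else 1) =
          (if z ∈ P then 0 else 1) + (if t ∈ P then 0 else 1) := by
      intro x y z t
      simp [φ]
    intro x hx y hy z hz t ht
    rw [hiff]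
    refine ⟨fun h => ⟨h, ?_⟩, And.left⟩
    grind
  · intro c t h
    simp only [Finset.mem_image, forall_exists_index, and_imp, forall_apply_eq_imp_iff₂,
      Fin.sum_univ_two] at h
    have hcP : ∀ x ∈ P, c 0 * x = t := fun x hx => by
      simpa [hφP x hx] using h x (Finset.mem_union_left _ hx)
    have hcQ : ∀ x ∈ Q, c 0 * x + c 1 = t := fun x hx => by
      simpa [hφQ x hx] using h x (Finset.mem_union_right _ hx)
    have hc0 : c 0 = 0 := by
      rcases hbig with hb | hb
      · obtain ⟨x, hx, y, hy, hxy⟩ := Finset.one_lt_card.1 hb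
        exact (mul_eq_mul_left_iff.1 ((hcP x hx).trans (hcP y hy).symm)).resolve_left hxy
      · obtain ⟨x, hx, y, hy, hxy⟩ := Finset.one_lt_card.1 hb
        exact (mul_eq_mul_left_iff.1
          (add_right_cancel ((hcQ x hx).trans (hcQ y hy).symm))).resolve_left hxy
    obtain ⟨p, hp⟩ := hP
    obtain ⟨q, hq⟩ := hQ
    have hc1 : c 1 = 0 := by
      have hp' := hcP p hp
      have hq' := hcQ q hq
      rw [hc0] at hp' hq'
      linarith
    ext i
    fin_cases i
    exacts [hc0, hc1]

/-- A union of two segments whose three pairwise sums are disjoint is `2`-dimensional. -/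
theorem two_segments_disjoint_sums_dim_two (P₁ P₂ : Finset ℤ)
    (h₁ : ∃ a b : ℤ, a ≤ b ∧ P₁ = Finset.Icc a b)
    (h₂ : ∃ a b : ℤ, a ≤ b ∧ P₂ = Finset.Icc a b)
    (hsep : ∀ x ∈ P₁, ∀ y ∈ P₂, x + 1 < y)
    (hbig : 1 < P₁.card ∨ 1 < P₂.card)
    (hd1 : Disjoint (P₁ + P₁) (P₁ + P₂))
    (hd2 : Disjoint (P₁ + P₁) (P₂ + P₂))
    (hd3 : Disjoint (P₁ + P₂) (P₂ + P₂)) :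
    HasAddDim (P₁ ∪ P₂) 2 := by
  obtain ⟨a, b, hab, rfl⟩ := h₁
  obtain ⟨c, e, hce, rfl⟩ := h₂
  refine ⟨hasFullDimWitness_two_of_disjoint_sums (Finset.nonempty_Icc.2 hab)
    (Finset.nonempty_Icc.2 hce) ?_ hbig hd1 hd2 hd3,
    fun d hd => hd.le_two_of_Icc_union_Icc⟩
  rw [Finset.disjoint_left]
  intro x hx hx'
  have := hsep x hx x hx'
  omega
end

section
/- Let A ⊆ ℤ be a finite set of cardinality k ≥ 2 and additive dimension 1. Then vol(A) ≤ 2^{k−2} + 1. -/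
open Pointwise

/-- A matrix each of whose rows is a difference of two vectors, each the indicator of at most one
column, has determinant `0` or `±1`. -/
theorem abs_det_indicator_sub_le_one {α : Type*} [DecidableEq α] (n : ℕ) (g : Fin n → α)
    (hg : Function.Injective g) (p q : Fin n → α) :
    |(Matrix.of fun i j : Fin n =>
      (if p i = g j then (1 : ℤ) else 0) - (if q i = g j then 1 else 0)).det| ≤ 1 := by
  induction n with
  | zero => simp
  | succ n ih =>
    set M := Matrix.of fun i j : Fin (n + 1) =>
      (if p i = g j then (1 : ℤ) else 0) - (if q i = g j then 1 else 0) with hM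
    have key : ∀ i j₀, |M i j₀| ≤ 1 → (∀ j, j ≠ j₀ → M i j = 0) → |M.det| ≤ 1 := by
      intro i j₀ h1 h0
      rw [Matrix.det_succ_row M i, Finset.sum_eq_single j₀]
      · rw [abs_mul, abs_mul, abs_pow, abs_neg, abs_one, one_pow, one_mul]
        exact mul_le_one₀ h1 (abs_nonneg _)
          (ih (g ∘ j₀.succAbove) (hg.comp Fin.succAbove_right_injective)
            (p ∘ i.succAbove) (q ∘ i.succAbove))
      · intro j _ hj
        simp [h0 j hj]
      · simp
    by_cases hrow : ∀ i, ∑ j, M i j = 0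
    · have hdet : M.det = 0 := by
        refine Matrix.exists_mulVec_eq_zero_iff.1 ⟨fun _ => 1, ?_, ?_⟩
        · exact fun h => one_ne_zero (congrFun h 0)
        · ext i
          simpa [Matrix.mulVec, dotProduct] using hrow i
      simp [hdet]
    · push Not at hrow
      obtain ⟨i, hi⟩ := hrow
      by_cases hp : ∃ j, p i = g j
      · obtain ⟨j, hj⟩ := hp
        by_cases hq : ∃ j, q i = g j
        · obtain ⟨l, hl⟩ := hq
          refine absurd ?_ hi
          simp [hM, hj, hl, hg.eq_iff]
        · push Not at hq
          refine key i j ?_ fun l hl => ?_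
          · simp [hM, hj, hq]
          · simp [hM, hj, hq, hg.eq_iff, hl.symm]
      · push Not at hp
        by_cases hq : ∃ j, q i = g j
        · obtain ⟨j, hj⟩ := hq
          refine key i j ?_ fun l hl => ?_
          · simp [hM, hj, hp]
          · simp [hM, hj, hp, hg.eq_iff, hl.symm]
        · push Not at hq
          exact key i 0 (by simp [hM, hp, hq]) fun l _ => by simp [hM, hp, hq]

/-- If the determinant is at most `1` in absolute value on matrices with rows in `P`, then it is at
most `2 ^ #T` on matrices whose rows lie in `P` outside `T` and are sums of two elements of `P`
inside `T`. -/
theorem abs_det_le_two_pow {ι : Type*} [Fintype ι] [DecidableEq ι] (P : Set (ι → ℤ))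
    (hP : ∀ M : Matrix ι ι ℤ, (∀ i, M i ∈ P) → |M.det| ≤ 1) (T : Finset ι)
    (M : Matrix ι ι ℤ) (hT : ∀ i ∈ T, ∃ u ∈ P, ∃ w ∈ P, M i = u + w)
    (hM : ∀ i ∉ T, M i ∈ P) : |M.det| ≤ 2 ^ T.card := by
  induction T using Finset.induction_on generalizing M with
  | empty => simpa using hP M fun i => hM i (by simp)
  | insert i T hi ih =>
    obtain ⟨u, hu, w, hw, huw⟩ := hT i (by simp)
    have step : ∀ v ∈ P, |(M.updateRow i v).det| ≤ 2 ^ T.card := by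
      intro v hv
      refine ih _ (fun l hl => ?_) fun l hl => ?_
      · rw [Matrix.updateRow_ne (ne_of_mem_of_not_mem hl hi)]
        exact hT l (by simp [hl])
      · by_cases h : l = i
        · subst h
          rwa [Matrix.updateRow_self]
        · rw [Matrix.updateRow_ne h]
          exact hM l (by simp [h, hl])
    have hdet : M.det = (M.updateRow i u).det + (M.updateRow i w).det := by
      rw [← Matrix.det_updateRow_add, ← huw, Matrix.updateRow_eq_self]
    rw [hdet, Finset.card_insert_of_notMem hi, pow_succ, mul_two]
    exact (abs_add_le _ _).trans (add_le_add (step u hu) (step w hw))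

/-- The indicator row of an optional index. -/
def optionIndicator {ι : Type*} [DecidableEq ι] (p : Option ι) : ι → ℤ :=
  fun j => if p = some j then 1 else 0

/-- The coefficient row of the equation `x + y = z + t`. -/
def quadrupleRow {ι : Type*} [DecidableEq ι] (x y z t : ι) : ι → ℤ :=
  (optionIndicator (some x) - optionIndicator (some z)) +
    (optionIndicator (some y) - optionIndicator (some t))

theorem optionIndicator_some_dotProduct {ι : Type*} [Fintype ι] [DecidableEq ι] (x : ι)
    (f : ι → ℤ) : optionIndicator (some x) ⬝ᵥ f = f x := by
  simp [optionIndicator, dotProduct]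

theorem quadrupleRow_dotProduct {ι : Type*} [Fintype ι] [DecidableEq ι] (x y z t : ι)
    (f : ι → ℤ) : quadrupleRow x y z t ⬝ᵥ f = f x - f z + (f y - f t) := by
  simp [quadrupleRow, add_dotProduct, sub_dotProduct, optionIndicator_some_dotProduct]

/-- A set of integer vectors that is annihilated only by `0` and contains two distinguished
linearly independent vectors contains the rows of a nonsingular matrix including those two. -/
theorem exists_det_ne_zero_of_dotProduct_eq_zero {n : ℕ} (S : Set (Fin n → ℤ)) (r s : Fin n → ℤ)
    (hr : r ∈ S) (hs : s ∈ S)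
    (hrs : ∀ c d : ℚ, (c • fun j => (r j : ℚ)) + (d • fun j => (s j : ℚ)) = 0 → c = 0 ∧ d = 0)
    (hS : ∀ f : Fin n → ℤ, (∀ v ∈ S, v ⬝ᵥ f = 0) → f = 0) :
    ∃ M : Matrix (Fin n) (Fin n) ℤ, (∀ i, M i ∈ S) ∧ M.det ≠ 0 ∧
      ∃ i j, i ≠ j ∧ M i = r ∧ M j = s := by
  classical
  let γ : (Fin n → ℤ) → (Fin n → ℚ) := fun v j => (v j : ℚ)
  have hγ : Function.Injective γ := fun v w h => by
    ext j
    exact Int.cast_injective (α := ℚ) (congrFun h j)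
  have hspan : Submodule.span ℚ (γ '' S) = ⊤ := by
    by_contra hne
    obtain ⟨φ, hφ, hle⟩ := Submodule.exists_le_ker_of_lt_top _ (lt_top_iff_ne_top.2 hne)
    obtain ⟨D, hD⟩ := IsLocalization.exist_integer_multiples_of_finite
      (nonZeroDivisors ℤ) (fun j : Fin n => φ (Pi.single j 1))
    choose f hf using hD
    have hD0 : ((D : ℤ) : ℚ) ≠ 0 := by
      exact_mod_cast nonZeroDivisors.ne_zero D.2
    have hf' : ∀ j, (f j : ℚ) = (D : ℤ) * φ (Pi.single j 1) := fun j => by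
      simpa using hf j
    have hφv : ∀ v : Fin n → ℚ, φ v = ∑ j, v j * φ (Pi.single j 1) := fun v => by
      conv_lhs => rw [pi_eq_sum_univ' v]
      simp [map_sum]
    have hf0 : f = 0 := by
      refine hS f fun v hv => ?_
      have h0 : φ (γ v) = 0 := hle (Submodule.subset_span ⟨v, hv, rfl⟩)
      rw [hφv] at h0
      have : ((v ⬝ᵥ f : ℤ) : ℚ) = (D : ℤ) * ∑ j, γ v j * φ (Pi.single j 1) := by
        rw [Finset.mul_sum]
        simp only [dotProduct, Int.cast_sum, Int.cast_mul, hf', γ]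
        exact Finset.sum_congr rfl fun j _ => by ring
      rw [h0, mul_zero] at this
      exact_mod_cast this
    refine hφ (LinearMap.ext fun v => ?_)
    rw [hφv]
    refine Finset.sum_eq_zero fun j _ => ?_
    have := hf' j
    simp only [hf0, Pi.zero_apply, Int.cast_zero, zero_eq_mul, hD0, false_or] at this
    rw [this, mul_zero]
  have hne : γ r ≠ γ s := fun h => by
    have := hrs 1 (-1) (by
      change (1 : ℚ) • γ r + (-1 : ℚ) • γ s = 0
      rw [h]; simp)
    exact one_ne_zero this.1
  have hli : LinearIndepOn ℚ id ({γ r, γ s} : Set (Fin n → ℚ)) :=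
    (LinearIndepOn.pair_iff id hne).2 hrs
  obtain ⟨b, hbS, hrsb, hSb, hb⟩ := exists_linearIndepOn_id_extension hli
    (t := γ '' S) (by
      rintro _ (rfl | rfl)
      exacts [⟨r, hr, rfl⟩, ⟨s, hs, rfl⟩])
  have hbtop : ⊤ ≤ Submodule.span ℚ (Set.range ((↑) : b → Fin n → ℚ)) := by
    rw [Subtype.range_coe, ← hspan]
    exact Submodule.span_le.2 hSb
  let β := Module.Basis.mk hb hbtop
  let σ : b ≃ Fin n := β.indexEquiv (Pi.basisFun ℚ (Fin n))
  have hrow : ∀ i, ∃ v ∈ S, γ v = (σ.symm i : Fin n → ℚ) := fun i => hbS (σ.symm i).2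
  choose M hMS hM using hrow
  have hdet : (Matrix.of M).det ≠ 0 := by
    have hind : LinearIndependent ℚ ((Matrix.of M).map (Int.cast : ℤ → ℚ)).row := by
      have : ((Matrix.of M).map (Int.cast : ℤ → ℚ)).row = (fun v : b => (v : Fin n → ℚ)) ∘ σ.symm :=
        funext hM
      rw [this]
      exact LinearIndependent.comp hb _ σ.symm.injective
    rw [Matrix.linearIndependent_rows_iff_isUnit, Matrix.isUnit_iff_isUnit_det] at hind
    have h := hind.ne_zero
    intro h0
    exact h (by rw [← Int.cast_det, h0, Int.cast_zero])
  refine ⟨Matrix.of M, hMS, hdet, σ ⟨γ r, hrsb (by simp)⟩, σ ⟨γ s, hrsb (by simp)⟩, ?_, ?_, ?_⟩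
  · simpa using hne
  · exact hγ ((hM _).trans (by simp))
  · exact hγ ((hM _).trans (by simp))

/-- If every integer solution of the additive relations of a strictly increasing `a` is an affine
image of `a`, then rescaling `a` linearly so that `a 0 = 0` and `a (last) = D` yields integers, for
some `0 < D ≤ 2 ^ n`. -/
theorem exists_integer_rescaling {n : ℕ} (a : Fin (n + 2) → ℤ) (ha : StrictMono a)
    (H : ∀ f : Fin (n + 2) → ℤ,
      (∀ x y z t, a x + a y = a z + a t → f x + f y = f z + f t) →
      ∃ u c e : ℤ, u ≠ 0 ∧ ∀ i, u * f i = e - c * a i) :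
    ∃ (D : ℤ) (m : Fin (n + 2) → ℤ), 0 < D ∧ D ≤ 2 ^ n ∧
      ∀ l, (a (Fin.last _) - a 0) * m l = D * (a l - a 0) := by
  have h0l : (0 : Fin (n + 2)) ≠ Fin.last _ := (Fin.last_pos).ne
  let E : Set (Fin (n + 2) → ℤ) :=
    {v | ∃ x y z t, a x + a y = a z + a t ∧ v = quadrupleRow x y z t}
  let r : Fin (n + 2) → ℤ := optionIndicator (some 0)
  let s : Fin (n + 2) → ℤ := optionIndicator (some (Fin.last _))
  obtain ⟨M, hMS, hdet, i, j, hij, hi, hj⟩ := exists_det_ne_zero_of_dotProduct_eq_zero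
    (insert r (insert s E)) r s (by simp) (by simp)
    (by
      intro c d h
      have h1 := congrFun h 0
      have h2 := congrFun h (Fin.last _)
      simp [r, s, optionIndicator, h0l, h0l.symm] at h1 h2
      exact ⟨h1, h2⟩)
    (by
      intro f hf
      obtain ⟨u, c, e, hu, hf'⟩ := H f fun x y z t h => by
        have := hf _ (Or.inr (Or.inr ⟨x, y, z, t, h, rfl⟩))
        rw [quadrupleRow_dotProduct] at this
        linarith
      have hf0 : f 0 = 0 := by
        have := hf r (by simp)
        rwa [optionIndicator_some_dotProduct] at this
      have hfl : f (Fin.last _) = 0 := by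
        have := hf s (by simp)
        rwa [optionIndicator_some_dotProduct] at this
      have e0 := hf' 0
      have el := hf' (Fin.last _)
      rw [hf0, mul_zero] at e0
      rw [hfl, mul_zero] at el
      have hc : c * (a (Fin.last _) - a 0) = 0 := by linarith
      have hc0 : c = 0 := (mul_eq_zero.1 hc).resolve_right
        (sub_ne_zero.2 (ha Fin.last_pos).ne')
      ext l
      have := hf' l
      rw [hc0] at this e0
      refine (mul_eq_zero.1 (?_ : u * f l = 0)).resolve_left hu
      linarith)
  have hinj : ∀ l l', M l = M l' → l = l' := fun l l' h => by
    by_contra hne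
    exact hdet (Matrix.det_zero_of_row_eq hne h)
  have hE : ∀ l, l ≠ i → l ≠ j → M l ∈ E := fun l hli hlj => by
    rcases hMS l with h | h | h
    · exact absurd (hinj l i (h.trans hi.symm)) hli
    · exact absurd (hinj l j (h.trans hj.symm)) hlj
    · exact h
  have hbound : |M.det| ≤ 2 ^ n := by
    have hP : ∀ N : Matrix (Fin (n + 2)) (Fin (n + 2)) ℤ,
        (∀ l, N l ∈ {v | ∃ p q, v = optionIndicator p - optionIndicator q}) →
        |N.det| ≤ 1 := by
      intro N hN
      choose p q hpq using hN
      have := abs_det_indicator_sub_le_one (n + 2) some (Option.some_injective _) p q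
      convert this using 3
      ext l l'
      rw [hpq l]
      rfl
    have hnone : optionIndicator (none : Option (Fin (n + 2))) = 0 := by
      ext
      simp [optionIndicator]
    have := abs_det_le_two_pow _ hP ({i, j}ᶜ) M
      (by
        intro l hl
        simp only [Finset.mem_compl, Finset.mem_insert, Finset.mem_singleton, not_or] at hl
        obtain ⟨x, y, z, t, -, h⟩ := hE l hl.1 hl.2
        exact ⟨_, ⟨_, _, rfl⟩, _, ⟨_, _, rfl⟩, h⟩)
      (by
        intro l hl
        simp only [Finset.mem_compl, Finset.mem_insert, Finset.mem_singleton, not_not] at hl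
        rcases hl with rfl | rfl
        · exact ⟨some 0, none, by rw [hi, hnone, sub_zero]⟩
        · exact ⟨some (Fin.last _), none, by rw [hj, hnone, sub_zero]⟩)
    rwa [Finset.card_compl, Finset.card_pair hij, Fintype.card_fin, Nat.add_sub_cancel] at this
  let m := M.cramer (Pi.single j 1)
  have hm : ∀ l, M l ⬝ᵥ m = M.det * (Pi.single j 1 : Fin (n + 2) → ℤ) l := fun l =>
    congrFun (Matrix.mulVec_cramer M (Pi.single j 1)) l
  let a' : Fin (n + 2) → ℤ := fun l => a l - a 0
  have ha' : ∀ l, M l ⬝ᵥ a' =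
      (a (Fin.last _) - a 0) * (Pi.single j 1 : Fin (n + 2) → ℤ) l := fun l => by
    by_cases hlj : l = j
    · subst hlj
      rw [hj, optionIndicator_some_dotProduct, Pi.single_eq_same, mul_one]
    · rw [Pi.single_eq_of_ne hlj, mul_zero]
      by_cases hli : l = i
      · subst hli
        rw [hi, optionIndicator_some_dotProduct]
        exact sub_self _
      · obtain ⟨x, y, z, t, h, hl⟩ := hE l hli hlj
        rw [hl, quadrupleRow_dotProduct]
        simp only [a']
        linarith
  have hker : (a (Fin.last _) - a 0) • m - M.det • a' = 0 := by
    refine Matrix.eq_zero_of_mulVec_eq_zero hdet (funext fun l => ?_)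
    change M l ⬝ᵥ _ = 0
    rw [dotProduct_sub, dotProduct_smul, dotProduct_smul, hm, ha', smul_eq_mul, smul_eq_mul]
    ring
  have hma : ∀ l, (a (Fin.last _) - a 0) * m l = M.det * (a l - a 0) := fun l =>
    sub_eq_zero.1 (congrFun hker l)
  rcases hdet.lt_or_gt with hneg | hpos
  · refine ⟨-M.det, -m, neg_pos.2 hneg, (neg_le_abs _).trans hbound, fun l => ?_⟩
    rw [Pi.neg_apply, mul_neg, neg_mul, hma]
  · exact ⟨M.det, m, hpos, (le_abs_self _).trans hbound, hma⟩

/-- A subset of `ℤ¹` contained in an interval has at most as many hull points as the interval. -/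
theorem hullCard_le_of_mem_Icc (B : Finset (Fin 1 → ℤ)) (lo hi : ℤ)
    (hB : ∀ x ∈ B, x 0 ∈ Set.Icc lo hi) : hullCard B ≤ (hi + 1 - lo).toNat := by
  have hconv : Convex ℝ {y : Fin 1 → ℝ | y 0 ∈ Set.Icc (lo : ℝ) hi} :=
    (convex_Icc (lo : ℝ) hi).linear_preimage (LinearMap.proj (R := ℝ) (φ := fun _ : Fin 1 => ℝ) 0)
  have hsub : {x : Fin 1 → ℤ | (fun i => (x i : ℝ)) ∈ convexHull ℝ
      ((fun (v : Fin 1 → ℤ) (i : Fin 1) => (v i : ℝ)) '' (B : Set (Fin 1 → ℤ)))} ⊆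
      (fun (z : ℤ) (_ : Fin 1) => z) '' (Finset.Icc lo hi : Finset ℤ) := by
    intro x hx
    have := convexHull_min (t := {y : Fin 1 → ℝ | y 0 ∈ Set.Icc (lo : ℝ) hi}) (by
      rintro _ ⟨v, hv, rfl⟩
      obtain ⟨h1, h2⟩ := hB v hv
      exact ⟨Int.cast_le.2 h1, Int.cast_le.2 h2⟩) hconv hx
    obtain ⟨h1, h2⟩ := this
    refine ⟨x 0, ?_, ?_⟩
    · simp only [Finset.coe_Icc, Set.mem_Icc]
      exact ⟨Int.cast_le.1 h1, Int.cast_le.1 h2⟩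
    · ext l
      rw [Subsingleton.elim l 0]
  calc hullCard B ≤ _ := Set.ncard_le_ncard hsub ((Finset.finite_toSet _).image _)
    _ ≤ _ := Set.ncard_image_le (Finset.finite_toSet _)
    _ = _ := by rw [Set.ncard_coe_finset, Int.card_Icc]

/-- On a set of additive dimension at most `1` every integer solution of its additive relations is
an affine image of the set. -/
theorem exists_affine_of_dim_le_one (A : Finset ℤ) (hA : 2 ≤ A.card)
    (hd : ∀ d, HasFullDimWitness A d → d ≤ 1) (f : ℤ → ℤ)
    (hf : ∀ x ∈ A, ∀ y ∈ A, ∀ z ∈ A, ∀ t ∈ A, x + y = z + t → f x + f y = f z + f t) :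
    ∃ u c e : ℤ, u ≠ 0 ∧ ∀ x ∈ A, u * f x = e - c * x := by
  let φ : ℤ → Fin 2 → ℤ := fun x => ![x, f x]
  have hφ : Function.Injective φ := fun x y h => congrFun h 0
  have hiso : F2Isomorphic A (A.image φ) := by
    refine ⟨φ, ?_, fun x hx y hy z hz t ht => ⟨fun h => ?_, fun h => congrFun h 0⟩⟩
    · rw [Finset.coe_image]
      exact hφ.injOn.bijOn_image
    · ext l
      fin_cases l
      · exact h
      · exact hf x hx y hy z hz t ht h
  have hdeg : ¬ NotInAffineHyperplane (A.image φ) := fun h =>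
    absurd (hd 2 ⟨_, hiso, h⟩) (by norm_num)
  unfold NotInAffineHyperplane at hdeg
  push Not at hdeg
  obtain ⟨c, e, h, hc⟩ := hdeg
  have hx : ∀ x ∈ A, c 0 * x + c 1 * f x = e := fun x hx => by
    simpa [φ, Fin.sum_univ_two] using h _ (Finset.mem_image_of_mem φ hx)
  refine ⟨c 1, c 0, e, fun h1 => hc ?_, fun x h => by linarith [hx x h]⟩
  obtain ⟨x, hxA, y, hyA, hxy⟩ := Finset.one_lt_card.1 hA
  have h0 : c 0 * (x - y) = 0 := by
    have := hx x hxA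
    have := hx y hyA
    rw [h1] at *
    linarith
  ext l
  fin_cases l
  · exact (mul_eq_zero.1 h0).resolve_right (sub_ne_zero.2 hxy)
  · exact h1

/-- Freiman's bound: a `1`-dimensional set of cardinality `k ≥ 2` has volume at most
`2^(k-2) + 1`. -/
theorem volume_bound_one_dimensional (A : Finset ℤ) (k : ℕ) (hk : A.card = k) (h2 : 2 ≤ k)
    (hd : HasAddDim A 1) (v : ℕ) (hv : HasVolume A v) :
    v ≤ 2 ^ (k - 2) + 1 := by
  obtain ⟨n, rfl⟩ : ∃ n, k = n + 2 := ⟨k - 2, by omega⟩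
  obtain ⟨d, hd', hv⟩ := hv
  obtain rfl : d = 1 := le_antisymm (hd.2 d hd'.1) (hd'.2 1 hd.1)
  rw [Nat.add_sub_cancel]
  let a := A.orderEmbOfFin hk
  have haA : ∀ i, a i ∈ A := A.orderEmbOfFin_mem hk
  have hinv : ∀ i, Function.invFun a (a i) = i := Function.leftInverse_invFun a.injective
  have hsurj : ∀ x ∈ A, ∃ i, a i = x := fun x hx =>
    (A.range_orderEmbOfFin hk).ge (Finset.mem_coe.2 hx)
  have haff : ∀ f : Fin (n + 2) → ℤ,
      (∀ x y z t, a x + a y = a z + a t → f x + f y = f z + f t) →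
      ∃ u c e : ℤ, u ≠ 0 ∧ ∀ i, u * f i = e - c * a i := by
    intro f hf
    obtain ⟨u, c, e, hu, h⟩ := exists_affine_of_dim_le_one A (by omega) hd.2
      (f ∘ Function.invFun a) (by
        intro x hx y hy z hz t ht h
        obtain ⟨x, rfl⟩ := hsurj x hx
        obtain ⟨y, rfl⟩ := hsurj y hy
        obtain ⟨z, rfl⟩ := hsurj z hz
        obtain ⟨t, rfl⟩ := hsurj t ht
        simpa [hinv] using hf x y z t h)
    exact ⟨u, c, e, hu, fun i => by simpa [hinv] using h (a i) (haA i)⟩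
  obtain ⟨D, m, hD, hDn, hm⟩ := exists_integer_rescaling a a.strictMono haff
  have hL : 0 < a (Fin.last _) - a 0 := sub_pos.2 (a.strictMono Fin.last_pos)
  let φ : ℤ → Fin 1 → ℤ := fun x _ => m (Function.invFun a x)
  have hiff : ∀ x ∈ A, ∀ y ∈ A, ∀ z ∈ A, ∀ t ∈ A,
      (x + y = z + t ↔ φ x + φ y = φ z + φ t) := by
    intro x hx y hy z hz t ht
    obtain ⟨x, rfl⟩ := hsurj x hx
    obtain ⟨y, rfl⟩ := hsurj y hy
    obtain ⟨z, rfl⟩ := hsurj z hz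
    obtain ⟨t, rfl⟩ := hsurj t ht
    have hsum : (a (Fin.last _) - a 0) * (m x + m y - (m z + m t)) =
        D * (a x + a y - (a z + a t)) := by
      linear_combination hm x + hm y - hm z - hm t
    have hφ : φ (a x) + φ (a y) = φ (a z) + φ (a t) ↔ m x + m y = m z + m t := by
      simp [φ, hinv, funext_iff]
    rw [hφ, ← sub_eq_zero, ← sub_eq_zero (a := m x + m y),
      ← mul_eq_zero_iff_left (b := m x + m y - (m z + m t)) hL.ne', hsum,
      mul_eq_zero_iff_left hD.ne']
  have hinj : Set.InjOn φ A := fun x hx y hy h =>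
    add_right_cancel ((hiff x hx x hx y hy x hx).2 (by rw [h]))
  have hiso : F2Isomorphic A (A.image φ) :=
    ⟨φ, by rw [Finset.coe_image]; exact hinj.bijOn_image, hiff⟩
  have hB : ∀ x ∈ A.image φ, x 0 ∈ Set.Icc 0 D := by
    intro x hx
    obtain ⟨y, hy, rfl⟩ := Finset.mem_image.1 hx
    obtain ⟨l, rfl⟩ := hsurj y hy
    have h0 : a 0 ≤ a l := a.monotone (Fin.zero_le _)
    have h1 : a l ≤ a (Fin.last _) := a.monotone (Fin.le_last _)
    have hl := hm l
    simp only [φ, hinv, Set.mem_Icc]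
    constructor
    · exact nonneg_of_mul_nonneg_right (hl ▸ mul_nonneg hD.le (sub_nonneg.2 h0)) hL
    · refine le_of_mul_le_mul_left ?_ hL
      rw [hl, mul_comm _ D]
      exact mul_le_mul_of_nonneg_left (by linarith) hD.le
  have hcard := (hv.2 ⟨_, hiso, rfl⟩).trans (hullCard_le_of_mem_Icc _ 0 D hB)
  have : ((2 ^ n : ℕ) : ℤ) = 2 ^ n := by push_cast; rfl
  omega
end
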